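/- Let U ⊆ ℝⁿ be an open connected neighbourhood of 0 and let f : U → ℝ be a real-analytic function, not identically zero, with f(0) = 0. Let P ∈ ℝ[x₁,…,xₙ,y] be an irreducible polynomial such that P(x, f(x)) = 0 for all x ∈ U, let d = deg P, let Z = {x ∈ U : f(x) = 0}, and set k = 2(2d−1)^(3n+1). Then for any two C^k functions f₁ : U₁ → ℝ and f₂ : U₂ → ℝ on open neighbourhoods U₁, U₂ of 0 that are both C^k-Z-realizations of the k-Z-jet of f, there exist open neighbourhoods Ω₁, Ω₂ ⊆ ℝⁿ of 0 and a homeomorphism φ : Ω₁ → Ω₂ such that f₁(φ(x)) = f₂(x) for all x ∈ Ω₁. -/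

import Mathlib

section MvPolynomialCalculus
open MvPolynomial

theorem hasDerivAt_eval_curve {σ : Type*} [Fintype σ] (p : MvPolynomial σ ℝ)
    {g : ℝ → σ → ℝ} {g' : σ → ℝ} {s : ℝ} (hg : ∀ v, HasDerivAt (fun s => g s v) (g' v) s) :
    HasDerivAt (fun s => eval (g s) p) (∑ v, g' v * eval (g s) (pderiv v p)) s := by
  classical
  induction p using MvPolynomial.induction_on with
  | C a => simpa using hasDerivAt_const s a
  | add p q hp hq =>
    simp only [map_add, mul_add, Finset.sum_add_distrib]
    exact hp.add hq
  | mul_X p v hp =>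
    have h := hp.mul (hg v)
    simp only [map_mul, eval_X]
    refine h.congr_deriv ?_
    simp only [pderiv_mul, map_add, map_mul, eval_X, mul_add, Finset.sum_add_distrib,
      Finset.sum_mul, pderiv_X]
    congr 1
    · exact Finset.sum_congr rfl fun w _ => by ring
    · rw [Finset.sum_eq_single v]
      · simp; ring
      · intro w _ hw
        simp [hw.symm]
      · simp

theorem totalDegree_pderiv_le_sub_one {σ R : Type*} [CommRing R] (v : σ) (p : MvPolynomial σ R) :
    (pderiv v p).totalDegree ≤ p.totalDegree - 1 := by
  classical
  refine Finset.sup_le fun m hm => ?_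
  have h1 : m + Finsupp.single v 1 ∈ p.support := by
    rw [mem_support_iff] at hm ⊢
    intro h0
    rw [coeff_pderiv, h0] at hm
    simp at hm
  have h2 : (m + Finsupp.single v 1).degree ≤ p.totalDegree := le_totalDegree h1
  rw [map_add, Finsupp.degree_single] at h2
  change m.degree ≤ _
  omega

theorem totalDegree_aeval_le {σ τ R S : Type*} [CommRing R] [CommRing S] [Algebra R S]
    (g : σ → MvPolynomial τ S) (hg : ∀ i, (g i).totalDegree ≤ 1) (p : MvPolynomial σ R) :
    (aeval g p).totalDegree ≤ p.totalDegree := by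
  classical
  rw [aeval_def, eval₂_eq]
  refine (totalDegree_finsetSum _ _).trans (Finset.sup_le fun m hm => ?_)
  have h2 : m.degree ≤ p.totalDegree := le_totalDegree hm
  refine le_trans ?_ h2
  refine (totalDegree_mul _ _).trans ?_
  rw [IsScalarTower.algebraMap_apply R S (MvPolynomial τ S), algebraMap_eq, totalDegree_C, zero_add]
  refine (totalDegree_finsetProd _ _).trans ?_
  rw [Finsupp.degree_apply]
  refine Finset.sum_le_sum fun i _ => ?_
  refine (totalDegree_pow _ _).trans ?_
  nlinarith [hg i]

theorem eval_pderiv_eq_zero_of_isLocalMin {σ : Type*} [Fintype σ] (p : MvPolynomial σ ℝ)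
    {z : σ → ℝ} (h : IsLocalMin (fun z => eval z p) z) (v : σ) : eval z (pderiv v p) = 0 := by
  classical
  have hg : ∀ w, HasDerivAt (fun s => Function.update z v s w)
      (Pi.single (M := fun _ => ℝ) v (1 : ℝ) w) (z v) := by
    intro w
    by_cases hw : w = v
    · subst hw; simpa using hasDerivAt_id' (z w)
    · simpa [hw] using hasDerivAt_const (z v) (z w)
  have h1 := hasDerivAt_eval_curve p hg
  have h2 : IsLocalMin (fun s => eval (Function.update z v s) p) (z v) := by
    have hc : ContinuousAt (fun s => Function.update z v s) (z v) := by fun_prop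
    have h3 : Function.update z v (z v) = z := Function.update_eq_self v z
    have := hc.tendsto
    rw [h3] at this
    have h4 := this.eventually h
    filter_upwards [h4] with s hs
    rw [h3]; exact hs
  have h5 := h2.hasDerivAt_eq_zero h1
  simpa [Pi.single_apply] using h5

end MvPolynomialCalculus

section EliminationAlgebra
open MvPolynomial

theorem map_mem_of_monomials_mem {K σ M : Type*} [Field K] [AddCommGroup M] [Module K M]
    (φ : MvPolynomial σ K →ₗ[K] M) (W : Submodule K M) (p : MvPolynomial σ K)
    (h : ∀ x ∈ p.support, φ (monomial x 1) ∈ W) : φ p ∈ W := by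
  rw [p.as_sum, map_sum]
  refine Submodule.sum_mem _ fun x hx => ?_
  have : monomial x (coeff x p) = (coeff x p) • monomial x (1 : K) := by
    rw [smul_monomial, smul_eq_mul, mul_one]
  rw [this, map_smul]
  exact Submodule.smul_mem _ _ (h x hx)

theorem monomial_sub_mem_of_pow_dvd {K σ : Type*} [Field K] (D : ℕ)
    (a : K) (ha : a ≠ 0) (r : σ → MvPolynomial σ K) (v : σ) (m' : σ →₀ ℕ) :
    monomial (m' + Finsupp.single v D) (1 : K) - C (-a⁻¹) * (monomial m' (1 : K) * r v) ∈
      Ideal.span (Set.range fun v => C a * X v ^ D + r v) := by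
  have : monomial (m' + Finsupp.single v D) (1 : K) - C (-a⁻¹) * (monomial m' (1 : K) * r v) =
      (C a⁻¹ * monomial m' (1 : K)) * (C a * X v ^ D + r v) := by
    rw [X_pow_eq_monomial]
    have h1 : monomial (m' + Finsupp.single v D) (1 : K) =
      monomial m' (1 : K) * monomial (Finsupp.single v D) 1 := by
      rw [monomial_mul]; simp
    have h2 : (C a⁻¹ : MvPolynomial σ K) * C a = 1 := by
      rw [← C_mul, inv_mul_cancel₀ ha, C_1]
    rw [h1, C_neg]
    linear_combination (-(monomial m' (1 : K) * monomial (Finsupp.single v D) 1)) * h2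
  rw [this]
  exact Ideal.mul_mem_left _ _ (Ideal.subset_span ⟨v, rfl⟩)

theorem span_boundedMonomials_eq_top {K σ M : Type*} [Field K] [Fintype σ]
    [AddCommGroup M] [Module K M] (D : ℕ)
    (a : K) (ha : a ≠ 0) (r : σ → MvPolynomial σ K) (hr : ∀ v, (r v).totalDegree < D)
    (φ : MvPolynomial σ K →ₗ[K] M) (hsurj : Function.Surjective φ)
    (hker : ∀ p ∈ Ideal.span (Set.range fun v => C a * X v ^ D + r v), φ p = 0) :
    Submodule.span K (Set.range fun s : σ → Fin D =>
      φ (monomial (Finsupp.equivFunOnFinite.symm fun v => (s v : ℕ)) (1 : K))) = ⊤ := by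
  classical
  set W := Submodule.span K (Set.range fun s : σ → Fin D =>
      φ (monomial (Finsupp.equivFunOnFinite.symm fun v => (s v : ℕ)) (1 : K))) with hW
  have key : ∀ (N : ℕ) (m : σ →₀ ℕ), m.degree < N → φ (monomial m (1 : K)) ∈ W := by
    intro N
    induction N with
    | zero => intro m hm; omega
    | succ N ih =>
      intro m hm
      by_cases hall : ∀ v, m v < D
      · refine Submodule.subset_span ⟨fun v => ⟨m v, hall v⟩, ?_⟩
        have : Finsupp.equivFunOnFinite.symm (fun v => m v) = m := by ext; simp
        simp only [this]
      · push Not at hall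
        obtain ⟨v, hv⟩ := hall
        obtain ⟨m', rfl⟩ : ∃ m', m = m' + Finsupp.single v D :=
          ⟨m - Finsupp.single v D, by rw [tsub_add_cancel_of_le]; simpa using hv⟩
        have hdeg : (m' + Finsupp.single v D).degree = m'.degree + D := by
          rw [map_add]; simp
        have heq := hker _ (monomial_sub_mem_of_pow_dvd D a ha r v m')
        rw [map_sub, sub_eq_zero] at heq
        rw [heq]
        refine map_mem_of_monomials_mem φ W _ fun x hx => ih x ?_
        have h1 : x.degree ≤ _ := le_totalDegree hx
        refine lt_of_le_of_lt h1 ?_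
        calc (C (-a⁻¹) * (monomial m' (1 : K) * r v)).totalDegree
            ≤ 0 + (m'.degree + (r v).totalDegree) := by
              refine (totalDegree_mul _ _).trans (add_le_add (by simp) ?_)
              refine (totalDegree_mul _ _).trans (add_le_add ?_ le_rfl)
              rw [totalDegree_monomial _ one_ne_zero]; rfl
          _ < N := by have := hr v; omega
  rw [eq_top_iff]
  rintro x -
  obtain ⟨p, rfl⟩ := hsurj x
  exact map_mem_of_monomials_mem φ W p fun x _ => key _ x (Nat.lt_succ_self _)

theorem exists_algebraic_relation_field {K σ : Type*} [Field K] [Fintype σ] (D : ℕ)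
    (a : K) (ha : a ≠ 0) (r : σ → MvPolynomial σ K) (hr : ∀ v, (r v).totalDegree < D)
    (Y : MvPolynomial σ K) :
    ∃ c : Fin (D ^ Fintype.card σ + 1) → K, (∃ i, c i ≠ 0) ∧
      ∑ i, C (c i) * Y ^ (i : ℕ) ∈ Ideal.span (Set.range fun v => C a * X v ^ D + r v) := by
  classical
  set I := Ideal.span (Set.range fun v => C a * X v ^ D + r v) with hI
  let φ := (Ideal.Quotient.mkₐ K I)
  have hspan := span_boundedMonomials_eq_top D a ha r hr φ.toLinearMap
    (Ideal.Quotient.mkₐ_surjective K I) (fun p hp => Ideal.Quotient.eq_zero_iff_mem.2 hp)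
  have hfin : Module.Finite K (MvPolynomial σ K ⧸ I) :=
    Module.finite_def.2 (Submodule.fg_def.2 ⟨_, Set.finite_range _, hspan⟩)
  have hle := finrank_le_of_span_eq_top hspan
  have hnot : ¬ LinearIndependent K
      (fun i : Fin (D ^ Fintype.card σ + 1) => φ (Y ^ (i : ℕ))) := by
    intro h
    have := h.fintype_card_le_finrank
    simp only [Fintype.card_fin, Fintype.card_pi, Finset.prod_const, Finset.card_univ] at this hle
    omega
  obtain ⟨c, hc, hne⟩ := Fintype.not_linearIndependent_iff.1 hnot
  refine ⟨c, hne, ?_⟩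
  have h0 : φ (∑ i, C (c i) * Y ^ (i : ℕ)) = 0 := by
    rw [map_sum, ← hc]
    refine Finset.sum_congr rfl fun i _ => ?_
    rw [← smul_eq_C_mul, map_smul]
  exact Ideal.Quotient.eq_zero_iff_mem.1 h0

attribute [local instance] MvPolynomial.algebraMvPolynomial in
theorem exists_algebraic_relation {A σ : Type*} [CommRing A] [IsDomain A] [Fintype σ] (D : ℕ)
    (a : A) (ha : a ≠ 0) (r : σ → MvPolynomial σ A) (hr : ∀ v, (r v).totalDegree < D)
    (Y : MvPolynomial σ A) :
    ∃ c : Fin (D ^ Fintype.card σ + 1) → A, (∃ i, c i ≠ 0) ∧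
      ∑ i, C (c i) * Y ^ (i : ℕ) ∈ Ideal.span (Set.range fun v => C a * X v ^ D + r v) := by
  classical
  let K := FractionRing A
  let φ := algebraMap A K
  have hφ : Function.Injective φ := IsFractionRing.injective A K
  obtain ⟨c, ⟨i₀, hi₀⟩, hc⟩ := exists_algebraic_relation_field (K := K) D (φ a)
    (by rwa [Ne, map_eq_zero_iff _ hφ]) (fun v => map φ (r v))
    (fun v => lt_of_le_of_lt (Finset.sup_mono (support_map_subset φ (r v))) (hr v)) (map φ Y)
  obtain ⟨b, hb⟩ := IsLocalization.exist_integer_multiples_of_finite (nonZeroDivisors A) c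
  choose c' hc' using hb
  have hImap : Ideal.span (Set.range fun v => C (φ a) * X v ^ D + map φ (r v)) =
      Ideal.map (algebraMap (MvPolynomial σ A) (MvPolynomial σ K))
        (Ideal.span (Set.range fun v => C a * X v ^ D + r v)) := by
    rw [Ideal.map_span, ← Set.range_comp]
    congr 2
    funext v
    change _ = map φ (C a * X v ^ D + r v)
    simp only [map_add, map_mul, map_pow, map_C, map_X]
  have hmem : ∑ i, C (φ (c' i)) * (map φ Y) ^ (i : ℕ) ∈
      Ideal.span (Set.range fun v => C (φ a) * X v ^ D + map φ (r v)) := by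
    have : ∑ i, C (φ (c' i)) * (map φ Y) ^ (i : ℕ) =
        C (φ b) * ∑ i, C (c i) * (map φ Y) ^ (i : ℕ) := by
      rw [Finset.mul_sum]
      refine Finset.sum_congr rfl fun i _ => ?_
      have := hc' i
      rw [show φ (c' i) = φ b * c i by
        rw [show φ (c' i) = _ from this, Algebra.smul_def], C_mul, mul_assoc]
    rw [this]
    exact Ideal.mul_mem_left _ _ hc
  rw [hImap, IsLocalization.mem_map_algebraMap_iff
    (Submonoid.map C (nonZeroDivisors A)) (MvPolynomial σ K)] at hmem
  obtain ⟨⟨⟨y, hy⟩, ⟨s, hs⟩⟩, hx⟩ := hmem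
  obtain ⟨e, he, rfl⟩ := hs
  refine ⟨fun i => e * c' i, ⟨i₀, mul_ne_zero (nonZeroDivisors.ne_zero he) ?_⟩, ?_⟩
  · intro h0
    have := hc' i₀
    rw [h0, map_zero, Algebra.smul_def] at this
    have hbne : algebraMap A K b ≠ 0 := by
      rw [Ne, map_eq_zero_iff _ hφ]; exact nonZeroDivisors.ne_zero b.2
    exact (mul_ne_zero hbne hi₀) this.symm
  · have hinj : Function.Injective (map φ : MvPolynomial σ A → MvPolynomial σ K) :=
      map_injective φ hφ
    have : ∑ i, C (e * c' i) * Y ^ (i : ℕ) = y := by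
      apply hinj
      have hx' : (∑ i, C (φ (c' i)) * (map φ Y) ^ (i : ℕ)) * map φ (C e) = map φ y := hx
      rw [← hx', map_sum, Finset.sum_mul]
      refine Finset.sum_congr rfl fun i _ => ?_
      simp only [map_mul, map_pow, map_C]
      ring
    rw [this]
    exact hy

end EliminationAlgebra

section Specialization
open Polynomial Filter Topology

theorem exists_common_X_pow_factor {A ι : Type*} [CommRing A] [Fintype ι]
    (c : ι → A[X]) (hc : ∃ i, c i ≠ 0) :
    ∃ (m : ℕ) (c' : ι → A[X]), (∀ i, c i = X ^ m * c' i) ∧ ∃ i, (c' i).coeff 0 ≠ 0 := by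
  classical
  obtain ⟨i₀, hi₀⟩ := hc
  have hex : ∃ m, ∃ i, (c i).coeff m ≠ 0 := by
    by_contra! h
    exact hi₀ (Polynomial.ext fun m => by simpa using h m i₀)
  have hmin : ∀ i, X ^ (Nat.find hex) ∣ c i := by
    intro i
    rw [X_pow_dvd_iff]
    intro l hl
    have := Nat.find_min hex hl
    push Not at this
    exact this i
  choose c' hc' using hmin
  refine ⟨Nat.find hex, c', hc', ?_⟩
  obtain ⟨i, hi⟩ := Nat.find_spec hex
  refine ⟨i, ?_⟩
  rw [hc' i] at hi
  simpa [coeff_X_pow_mul'] using hi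

theorem exists_specialized_relation {A ι : Type*} [CommRing A] [Fintype ι]
    (c : ι → A[X]) (hc : ∃ i, c i ≠ 0) (d : ι → ℕ) :
    ∃ c₀ : ι → A, (∃ i, c₀ i ≠ 0) ∧ ∀ (φ : A →+* ℝ) (s v : ℕ → ℝ) (v₀ : ℝ),
      (∀ j, s j ≠ 0) → Tendsto s atTop (𝓝 0) → Tendsto v atTop (𝓝 v₀) →
      (∀ j, ∑ i, (c i).eval₂ φ (s j) * v j ^ d i = 0) → ∑ i, φ (c₀ i) * v₀ ^ d i = 0 := by
  obtain ⟨m, c', hc', hne⟩ := exists_common_X_pow_factor c hc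
  refine ⟨fun i => (c' i).coeff 0, hne, fun φ s v v₀ hs hs0 hv hrel => ?_⟩
  have h1 : ∀ j, ∑ i, (c' i).eval₂ φ (s j) * v j ^ d i = 0 := by
    intro j
    have := hrel j
    simp only [hc', eval₂_mul, eval₂_pow, eval₂_X, mul_assoc] at this
    rw [← Finset.mul_sum] at this
    exact (mul_eq_zero.1 this).resolve_left (pow_ne_zero _ (hs j))
  have h2 : Tendsto (fun j => ∑ i, (c' i).eval₂ φ (s j) * v j ^ d i) atTop
      (𝓝 (∑ i, φ ((c' i).coeff 0) * v₀ ^ d i)) := by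
    refine tendsto_finsetSum _ fun i _ => Tendsto.mul ?_ (hv.pow _)
    have hcont : Continuous fun x : ℝ => (c' i).eval₂ φ x := by
      simp only [eval₂_eq_eval_map]
      exact ((c' i).map φ).continuous
    have := (hcont.tendsto 0).comp hs0
    simpa [eval₂_at_zero, Function.comp_def] using this
  refine tendsto_nhds_unique h2 ?_
  simp only [h1]
  exact tendsto_const_nhds

end Specialization

section PenaltyMinimization
open Filter Topology

theorem exists_penalized_minimizers {X : Type*} [PseudoMetricSpace X] {K : Set X}
    (hK : IsCompact K) {z₀ : X} (hz₀ : z₀ ∈ K) {h E q : X → ℝ} (hh : ContinuousOn h K)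
    (hE : ContinuousOn E K) (hq : ContinuousOn q K) (hE0 : ∀ z ∈ K, 0 ≤ E z) (hEz : E z₀ = 0)
    (hinside : ∀ z ∈ K, E z = 0 → h z ≤ h z₀ → z ∈ interior K) :
    ∃ (η : ℕ → ℝ) (z : ℕ → X) (zb : X), (∀ j, 0 < η j) ∧ Tendsto η atTop (𝓝 0) ∧
      (∀ j, z j ∈ interior K) ∧
      (∀ j, IsMinOn (fun x => η j * h x + E x + η j ^ 2 * q x) K (z j)) ∧
      Tendsto z atTop (𝓝 zb) ∧ zb ∈ K ∧ E zb = 0 ∧ h zb ≤ h z₀ := by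
  let η : ℕ → ℝ := fun j => 1 / ((j : ℝ) + 1)
  have hηpos : ∀ j, 0 < η j := fun j => by positivity
  have hη0 : Tendsto η atTop (𝓝 0) := tendsto_one_div_add_atTop_nhds_zero_nat
  have hex : ∀ j, ∃ z ∈ K, IsMinOn (fun x => η j * h x + E x + η j ^ 2 * q x) K z := fun j =>
    hK.exists_isMinOn ⟨z₀, hz₀⟩
      (((continuousOn_const.mul hh).add hE).add (continuousOn_const.mul hq))
  choose z hzK hzmin using hex
  obtain ⟨zb, hzb, ψ, hψ, hlim⟩ := hK.tendsto_subseq hzK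
  have hηψ : Tendsto (fun j => η (ψ j)) atTop (𝓝 0) := hη0.comp hψ.tendsto_atTop
  have hlimK : Tendsto (z ∘ ψ) atTop (𝓝[K] zb) :=
    tendsto_nhdsWithin_iff.2 ⟨hlim, Eventually.of_forall fun j => hzK _⟩
  have hhl : Tendsto (fun j => h (z (ψ j))) atTop (𝓝 (h zb)) := (hh zb hzb).tendsto.comp hlimK
  have hEl : Tendsto (fun j => E (z (ψ j))) atTop (𝓝 (E zb)) := (hE zb hzb).tendsto.comp hlimK
  have hql : Tendsto (fun j => q (z (ψ j))) atTop (𝓝 (q zb)) := (hq zb hzb).tendsto.comp hlimK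
  have hcmp : ∀ j, η j * h (z j) + E (z j) + η j ^ 2 * q (z j) ≤
      η j * h z₀ + η j ^ 2 * q z₀ := fun j => by
    have := hzmin j hz₀
    simp only [hEz, Set.mem_ofPred_eq] at this
    linarith
  have hEzb : E zb = 0 := by
    refine le_antisymm ?_ (hE0 zb hzb)
    have h1 : Tendsto (fun j => η (ψ j) * h z₀ + η (ψ j) ^ 2 * q z₀ - η (ψ j) * h (z (ψ j))
        - η (ψ j) ^ 2 * q (z (ψ j))) atTop
        (𝓝 (0 * h z₀ + 0 ^ 2 * q z₀ - 0 * h zb - 0 ^ 2 * q zb)) :=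
      (((hηψ.mul_const _).add ((hηψ.pow 2).mul_const _)).sub (hηψ.mul hhl)).sub
        ((hηψ.pow 2).mul hql)
    have h2 := le_of_tendsto_of_tendsto' hEl h1 (fun j => by have := hcmp (ψ j); linarith)
    simpa using h2
  have hhzb : h zb ≤ h z₀ := by
    have h1 : Tendsto (fun j => h z₀ + η (ψ j) * q z₀ - η (ψ j) * q (z (ψ j))) atTop
        (𝓝 (h z₀ + 0 * q z₀ - 0 * q zb)) :=
      (tendsto_const_nhds.add (hηψ.mul_const _)).sub (hηψ.mul hql)
    have h2 := le_of_tendsto_of_tendsto' hhl h1 (fun j => by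
      have h3 := hcmp (ψ j)
      have h4 := hE0 _ (hzK (ψ j))
      have h5 : η (ψ j) * h (z (ψ j)) ≤
          η (ψ j) * (h z₀ + η (ψ j) * q z₀ - η (ψ j) * q (z (ψ j))) := by nlinarith
      exact le_of_mul_le_mul_left h5 (hηpos _))
    simpa using h2
  have hev : ∀ᶠ j in atTop, z (ψ j) ∈ interior K :=
    hlim (isOpen_interior.mem_nhds (hinside zb hzb hEzb hhzb))
  obtain ⟨N, hN⟩ := eventually_atTop.1 hev
  have hshift : Tendsto (fun j : ℕ => j + N) atTop atTop := tendsto_add_atTop_nat N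
  exact ⟨fun j => η (ψ (j + N)), fun j => z (ψ (j + N)), zb, fun j => hηpos _,
    hηψ.comp hshift, fun j => hN _ (Nat.le_add_left _ _), fun j => hzmin _,
    hlim.comp hshift, hzb, hEzb, hhzb⟩

end PenaltyMinimization

section CriticalRelation
open MvPolynomial Filter Topology

noncomputable def gradEnergy {n : ℕ} (P : MvPolynomial (Fin (n + 1)) ℝ) (t σ : ℝ)
    (z : Fin (n + 1) → ℝ) : ℝ :=
  z (Fin.last n) ^ 2 * (∑ i : Fin n, eval (Fin.snoc (fun i => z (Fin.castSucc i)) t)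
    (pderiv (Fin.castSucc i) P) ^ 2 + σ)

noncomputable def constraintEnergy {n : ℕ} (P : MvPolynomial (Fin (n + 1)) ℝ) (δ t : ℝ)
    (z : Fin (n + 1) → ℝ) : ℝ :=
  eval (Fin.snoc (fun i => z (Fin.castSucc i)) t) P ^ 2 +
    (z (Fin.last n) * eval (Fin.snoc (fun i => z (Fin.castSucc i)) t) (pderiv (Fin.last n) P) *
      (δ ^ 2 - ∑ i : Fin n, z (Fin.castSucc i) ^ 2) - 1) ^ 2

noncomputable def totalEnergy {n : ℕ} (P : MvPolynomial (Fin (n + 1)) ℝ) (δ : ℝ) (D : ℕ)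
    (t σ η : ℝ) (z : Fin (n + 1) → ℝ) : ℝ :=
  η * gradEnergy P t σ z + constraintEnergy P δ t z + η ^ 2 * ∑ v, z v ^ (D + 1)

noncomputable def paramLift (n : ℕ) {A : Type*} [CommRing A] [Algebra ℝ A] (tA : A) :
    MvPolynomial (Fin (n + 1)) ℝ →ₐ[ℝ] MvPolynomial (Fin (n + 1)) A :=
  aeval (Fin.snoc (α := fun _ => MvPolynomial (Fin (n + 1)) A)
    (fun i => X (Fin.castSucc i)) (C tA))

theorem totalDegree_paramLift_le {n : ℕ} {A : Type*} [CommRing A] [Nontrivial A] [Algebra ℝ A]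
    (tA : A) (p : MvPolynomial (Fin (n + 1)) ℝ) :
    (paramLift n tA p).totalDegree ≤ p.totalDegree := by
  refine totalDegree_aeval_le _ (fun i => ?_) p
  refine Fin.lastCases ?_ (fun i => ?_) i
  · simp
  · simp [totalDegree_X]

theorem eval₂_paramLift {n : ℕ} {A : Type*} [CommRing A] [Algebra ℝ A] (tA : A) (θ : A →ₐ[ℝ] ℝ)
    (p : MvPolynomial (Fin (n + 1)) ℝ) (z : Fin (n + 1) → ℝ) :
    eval₂ (θ : A →+* ℝ) z (paramLift n tA p) =
      eval (Fin.snoc (fun i => z (Fin.castSucc i)) (θ tA)) p := by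
  induction p using MvPolynomial.induction_on with
  | C a =>
    have h : paramLift n tA (C a) = C (algebraMap ℝ A a) :=
      (paramLift n tA).commutes a
    rw [h]
    simp
  | add p q hp hq => simp only [map_add, eval₂_add, hp, hq]
  | mul_X p v hp =>
    simp only [map_mul, eval₂_mul, hp, eval_X]
    congr 1
    refine Fin.lastCases ?_ (fun i => ?_) v
    · simp [paramLift]
    · simp [paramLift]

noncomputable def energyPoly {n : ℕ} {A : Type*} [CommRing A] [Algebra ℝ A] (tA σA ηA : A)
    (P : MvPolynomial (Fin (n + 1)) ℝ) (δ : ℝ) : MvPolynomial (Fin (n + 1)) A :=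
  C ηA * (X (Fin.last n) ^ 2 * (∑ i : Fin n, paramLift n tA (pderiv (Fin.castSucc i) P) ^ 2 +
      C σA)) +
    (paramLift n tA P ^ 2 + (X (Fin.last n) * paramLift n tA (pderiv (Fin.last n) P) *
      (C (algebraMap ℝ A (δ ^ 2)) - ∑ i : Fin n, X (Fin.castSucc i) ^ 2) - 1) ^ 2)

theorem eval₂_energyPoly {n : ℕ} {A : Type*} [CommRing A] [Algebra ℝ A] (tA σA ηA : A)
    (θ : A →ₐ[ℝ] ℝ) (P : MvPolynomial (Fin (n + 1)) ℝ) (δ : ℝ) (z : Fin (n + 1) → ℝ) :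
    eval₂ (θ : A →+* ℝ) z (energyPoly tA σA ηA P δ) =
      θ ηA * gradEnergy P (θ tA) (θ σA) z + constraintEnergy P δ (θ tA) z := by
  simp only [energyPoly, gradEnergy, constraintEnergy, eval₂_add, eval₂_mul, eval₂_pow, eval₂_C,
    eval₂_X, eval₂_sum, eval₂_sub, eval₂_paramLift, eval₂_one]
  simp

theorem totalDegree_energyPoly_le {n : ℕ} {A : Type*} [CommRing A] [Nontrivial A] [Algebra ℝ A]
    (tA σA ηA : A) (P : MvPolynomial (Fin (n + 1)) ℝ) (δ : ℝ) (hP : 1 ≤ P.totalDegree) :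
    (energyPoly tA σA ηA P δ).totalDegree ≤ 2 * P.totalDegree + 4 := by
  have hl : ∀ v, (paramLift n tA (pderiv v P)).totalDegree ≤ P.totalDegree - 1 := fun v =>
    (totalDegree_paramLift_le _ _).trans (totalDegree_pderiv_le_sub_one v P)
  have hP' := totalDegree_paramLift_le tA P
  have hsq : ∀ (p : MvPolynomial (Fin (n + 1)) A) (m : ℕ), p.totalDegree ≤ m →
      (p ^ 2).totalDegree ≤ 2 * m := fun p m h =>
    (totalDegree_pow p 2).trans (Nat.mul_le_mul_left _ h)
  have hX : ∀ v, (X v : MvPolynomial (Fin (n + 1)) A).totalDegree ≤ 1 := fun v => by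
    rw [totalDegree_X]
  refine (totalDegree_add _ _).trans (max_le ?_ ((totalDegree_add _ _).trans (max_le ?_ ?_)))
  · refine (totalDegree_mul _ _).trans ?_
    rw [totalDegree_C, zero_add]
    refine (totalDegree_mul _ _).trans ?_
    have h1 := hsq _ _ (hX (Fin.last n))
    have h2 : (∑ i : Fin n, paramLift n tA (pderiv (Fin.castSucc i) P) ^ 2 +
      C σA).totalDegree ≤ 2 * (P.totalDegree - 1) := by
      refine (totalDegree_add _ _).trans (max_le ?_ (by simp))
      exact (totalDegree_finsetSum _ _).trans (Finset.sup_le fun i _ => hsq _ _ (hl _))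
    omega
  · exact (hsq _ _ hP').trans (by omega)
  · refine (hsq _ (P.totalDegree + 2) ?_).trans (by omega)
    refine (totalDegree_sub _ _).trans (max_le ?_ (by simp))
    refine (totalDegree_mul _ _).trans ?_
    have h1 : (X (Fin.last n) * paramLift n tA (pderiv (Fin.last n) P)).totalDegree ≤
        P.totalDegree := by
      refine (totalDegree_mul _ _).trans ?_
      have := hX (Fin.last n)
      have := hl (Fin.last n)
      omega
    refine add_le_add h1 ((totalDegree_sub _ _).trans (max_le (by
      rw [totalDegree_C]; exact Nat.zero_le _) ?_))
    exact (totalDegree_finsetSum _ _).trans (Finset.sup_le fun i _ => hsq _ _ (hX _))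

theorem critical_equation {n : ℕ} {A : Type*} [CommRing A] [Algebra ℝ A] (tA σA ηA : A)
    (θ : A →ₐ[ℝ] ℝ) (P : MvPolynomial (Fin (n + 1)) ℝ) (δ : ℝ) (D : ℕ) (z : Fin (n + 1) → ℝ)
    (hz : IsLocalMin (totalEnergy P δ D (θ tA) (θ σA) (θ ηA)) z) (v : Fin (n + 1)) :
    eval₂ (θ : A →+* ℝ) z (C (algebraMap ℝ A ((D : ℝ) + 1) * ηA ^ 2) * X v ^ D +
        pderiv v (energyPoly tA σA ηA P δ)) = 0 := by
  classical
  let G : MvPolynomial (Fin (n + 1)) ℝ :=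
    map (θ : A →+* ℝ) (energyPoly tA σA ηA P δ) + C (θ ηA ^ 2) * ∑ v, X v ^ (D + 1)
  have hG : ∀ z, eval z G = totalEnergy P δ D (θ tA) (θ σA) (θ ηA) z := by
    intro z
    simp only [G, map_add, eval_map, map_mul, eval_C, map_sum, map_pow, eval_X, totalEnergy]
    rw [eval₂_energyPoly]
  have h := eval_pderiv_eq_zero_of_isLocalMin G (z := z) (by simpa only [hG] using hz) v
  have h2 : pderiv v G = map (θ : A →+* ℝ) (pderiv v (energyPoly tA σA ηA P δ)) +
      C (θ ηA ^ 2) * (C ((D : ℝ) + 1) * X v ^ D) := by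
    simp only [G, map_add, pderiv_map, pderiv_C_mul, map_sum]
    rw [Finset.sum_eq_single v]
    · rw [pderiv_pow, pderiv_X_self]
      simp
    · intro w _ hw
      rw [pderiv_pow, pderiv_X_of_ne hw]; simp
    · simp
  rw [h2] at h
  simp only [map_add, eval_map, map_mul, eval_C, map_pow, eval_X] at h
  simp only [eval₂_add, eval₂_mul, eval₂_C, eval₂_pow, eval₂_X]
  have h3 : (θ : A →+* ℝ) (algebraMap ℝ A ((D : ℝ) + 1) * ηA ^ 2) = ((D : ℝ) + 1) * θ ηA ^ 2 := by
    rw [RingHom.map_mul, RingHom.map_pow]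
    exact congrArg (· * θ ηA ^ 2) (θ.commutes _)
  rw [h3]
  linear_combination h

/-- A relation over a coefficient domain satisfied at every local minimum. -/
theorem exists_relation_at_minima {n : ℕ} {A : Type*} [CommRing A] [IsDomain A] [Algebra ℝ A]
    (tA σA ηA : A) (hηA : ηA ≠ 0) (P : MvPolynomial (Fin (n + 1)) ℝ)
    (hP : 1 ≤ P.totalDegree) (δ : ℝ) (Y : MvPolynomial (Fin (n + 1)) ℝ) :
    ∃ c : Fin ((2 * P.totalDegree + 4) ^ (n + 1) + 1) → A, (∃ i, c i ≠ 0) ∧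
      ∀ (θ : A →ₐ[ℝ] ℝ) (z : Fin (n + 1) → ℝ),
        IsLocalMin (totalEnergy P δ (2 * P.totalDegree + 4) (θ tA) (θ σA) (θ ηA)) z →
        ∑ i, θ (c i) * eval (Fin.snoc (fun i => z (Fin.castSucc i)) (θ tA)) Y ^ (i : ℕ) = 0 := by
  classical
  have hcard : Fintype.card (Fin (n + 1)) = n + 1 := Fintype.card_fin _
  set D := 2 * P.totalDegree + 4 with hD
  have hex := exists_algebraic_relation (A := A) (σ := Fin (n + 1)) D
    (algebraMap ℝ A ((D : ℝ) + 1) * ηA ^ 2)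
    (by
      refine mul_ne_zero ?_ (pow_ne_zero _ hηA)
      rw [Ne, map_eq_zero_iff _ (algebraMap ℝ A).injective]
      positivity)
    (fun v => pderiv v (energyPoly tA σA ηA P δ))
    (fun v => lt_of_le_of_lt (totalDegree_pderiv_le_sub_one v _) (by
      have := totalDegree_energyPoly_le tA σA ηA P δ hP
      omega)) (paramLift n tA Y)
  rw [hcard] at hex
  obtain ⟨c, hc, hmem⟩ := hex
  refine ⟨c, hc, fun θ z hz => ?_⟩
  have hle : Ideal.span (Set.range fun v => C (algebraMap ℝ A ((D : ℝ) + 1) * ηA ^ 2) * X v ^ D +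
      pderiv v (energyPoly tA σA ηA P δ)) ≤ RingHom.ker (eval₂Hom (θ : A →+* ℝ) z) := by
    rw [Ideal.span_le]
    rintro _ ⟨v, rfl⟩
    exact critical_equation tA σA ηA θ P δ D z hz v
  have h := hle hmem
  rw [RingHom.mem_ker] at h
  simp only [map_sum, map_mul, map_pow, coe_eval₂Hom, eval₂_C, eval₂_paramLift] at h
  exact h

noncomputable def paramEval (t σ η : ℝ) : Polynomial (Polynomial (Polynomial ℝ)) →ₐ[ℝ] ℝ where
  toRingHom := Polynomial.eval₂RingHom (Polynomial.eval₂RingHom (Polynomial.evalRingHom t) σ) η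
  commutes' r := by
    change Polynomial.eval₂ (Polynomial.eval₂RingHom (Polynomial.evalRingHom t) σ) η
      (Polynomial.C (Polynomial.C (Polynomial.C r))) = r
    simp

theorem exists_critical_relation {n : ℕ} (P : MvPolynomial (Fin (n + 1)) ℝ)
    (hP : 1 ≤ P.totalDegree) (δ : ℝ) (Y : MvPolynomial (Fin (n + 1)) ℝ) :
    ∃ c : Fin ((2 * P.totalDegree + 4) ^ (n + 1) + 1) → Polynomial ℝ, (∃ i, c i ≠ 0) ∧
      ∀ (t : ℝ) (σ : ℕ → ℝ) (η : ℕ → ℕ → ℝ) (z : ℕ → ℕ → Fin (n + 1) → ℝ)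
        (zb : ℕ → Fin (n + 1) → ℝ) (x : Fin n → ℝ),
        (∀ j, σ j ≠ 0) → Tendsto σ atTop (𝓝 0) → (∀ j l, η j l ≠ 0) →
        (∀ j, Tendsto (η j) atTop (𝓝 0)) →
        (∀ j l, IsLocalMin (totalEnergy P δ (2 * P.totalDegree + 4) t (σ j) (η j l)) (z j l)) →
        (∀ j, Tendsto (z j) atTop (𝓝 (zb j))) →
        Tendsto (fun j i => zb j (Fin.castSucc i)) atTop (𝓝 x) →
        ∑ i, (c i).eval t * eval (Fin.snoc x t) Y ^ (i : ℕ) = 0 := by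
  obtain ⟨c, hc, hrel⟩ := exists_relation_at_minima
    (Polynomial.C (Polynomial.C Polynomial.X) : Polynomial (Polynomial (Polynomial ℝ)))
    (Polynomial.C Polynomial.X) Polynomial.X Polynomial.X_ne_zero P hP δ Y
  obtain ⟨c₁, hc₁, hrel₁⟩ := exists_specialized_relation c hc (fun i => (i : ℕ))
  obtain ⟨c₂, hc₂, hrel₂⟩ := exists_specialized_relation c₁ hc₁ (fun i => (i : ℕ))
  refine ⟨c₂, hc₂, fun t σ η z zb x hσ hσ0 hη hη0 hmin hz hx => ?_⟩
  have hcont : Continuous fun x : Fin n → ℝ =>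
      eval (Fin.snoc (α := fun _ => ℝ) x t) Y := by
    refine (MvPolynomial.continuous_eval Y).comp ?_
    refine continuous_pi fun i => ?_
    refine Fin.lastCases ?_ (fun i => ?_) i
    · simpa using continuous_const
    · simpa using continuous_apply i
  refine hrel₂ (Polynomial.evalRingHom t) σ _ _ hσ hσ0 ((hcont.tendsto x).comp hx) fun j => ?_
  have hz' : Tendsto (fun l i => z j l (Fin.castSucc i)) atTop
      (𝓝 fun i => zb j (Fin.castSucc i)) :=
    tendsto_pi_nhds.2 fun i => (tendsto_pi_nhds.1 (hz j)) _
  refine hrel₁ (Polynomial.eval₂RingHom (Polynomial.evalRingHom t) (σ j)) (η j) _ _ (hη j) (hη0 j)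
    ((hcont.tendsto _).comp hz') fun l => ?_
  have h1 : paramEval t (σ j) (η j l) (Polynomial.C (Polynomial.C Polynomial.X)) = t := by
    change Polynomial.eval₂ (Polynomial.eval₂RingHom (Polynomial.evalRingHom t) (σ j)) (η j l) _ = _
    simp
  have h2 : paramEval t (σ j) (η j l) (Polynomial.C Polynomial.X) = σ j := by
    change Polynomial.eval₂ (Polynomial.eval₂RingHom (Polynomial.evalRingHom t) (σ j)) (η j l) _ = _
    simp
  have h3 : paramEval t (σ j) (η j l) Polynomial.X = η j l := by
    change Polynomial.eval₂ (Polynomial.eval₂RingHom (Polynomial.evalRingHom t) (σ j)) (η j l) _ = _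
    simp
  have h := hrel (paramEval t (σ j) (η j l)) (z j l)
  rw [h1, h2, h3] at h
  exact h (hmin j l)

end CriticalRelation

section ComparisonPoint
open MvPolynomial Filter Topology

/-- Evaluation of a polynomial in `n + 1` variables at the point `(x, t)`. -/
noncomputable def evalAt {n : ℕ} (p : MvPolynomial (Fin (n + 1)) ℝ) (x : Fin n → ℝ) (t : ℝ) : ℝ :=
  eval (Fin.snoc (α := fun _ => ℝ) x t) p

theorem continuous_evalAt {n : ℕ} (p : MvPolynomial (Fin (n + 1)) ℝ) :
    Continuous fun y : (Fin n → ℝ) × ℝ => evalAt p y.1 y.2 := by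
  refine (MvPolynomial.continuous_eval p).comp (continuous_pi fun i => ?_)
  refine Fin.lastCases ?_ (fun i => ?_) i
  · simpa using continuous_snd
  · simp only [Fin.snoc_castSucc]
    fun_prop

theorem hasDerivAt_evalAt {n : ℕ} (p : MvPolynomial (Fin (n + 1)) ℝ) (x : Fin n → ℝ) (s : ℝ) :
    HasDerivAt (fun s => evalAt p x s) (evalAt (pderiv (Fin.last n) p) x s) s := by
  have h := hasDerivAt_eval_curve p (g := fun s => Fin.snoc (α := fun _ => ℝ) x s)
    (g' := Fin.snoc (α := fun _ => ℝ) (fun _ => 0) 1) (s := s) (fun v => by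
      refine Fin.lastCases ?_ (fun i => ?_) v
      · simpa using hasDerivAt_id' s
      · simpa using hasDerivAt_const s (x i))
  rw [Fin.sum_univ_castSucc] at h
  simpa [evalAt] using h

theorem gradEnergy_eq {n : ℕ} (P : MvPolynomial (Fin (n + 1)) ℝ) (t σ : ℝ) :
    gradEnergy P t σ = fun z => z (Fin.last n) ^ 2 *
      (∑ i : Fin n, evalAt (pderiv (Fin.castSucc i) P) (Fin.init z) t ^ 2 + σ) := rfl

theorem constraintEnergy_eq {n : ℕ} (P : MvPolynomial (Fin (n + 1)) ℝ) (δ t : ℝ) :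
    constraintEnergy P δ t = fun z => evalAt P (Fin.init z) t ^ 2 +
      (z (Fin.last n) * evalAt (pderiv (Fin.last n) P) (Fin.init z) t *
        (δ ^ 2 - ∑ i : Fin n, Fin.init z i ^ 2) - 1) ^ 2 := rfl

attribute [irreducible] evalAt

theorem isCompact_sum_sq_le {n : ℕ} (R : ℝ) : IsCompact {x : Fin n → ℝ | ∑ i, x i ^ 2 ≤ R} := by
  refine Metric.isCompact_of_isClosed_isBounded (isClosed_le (by fun_prop) continuous_const) ?_
  refine (Metric.isBounded_closedBall (x := (0 : Fin n → ℝ)) (r := R + 1)).subset fun x hx => ?_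
  have hx' : ∑ i, x i ^ 2 ≤ R := hx
  rw [mem_closedBall_zero_iff]
  have hR : 0 ≤ R := (Finset.sum_nonneg fun i _ => sq_nonneg (x i)).trans hx'
  refine (pi_norm_le_iff_of_nonneg (by linarith)).2 fun i => ?_
  have h1 : x i ^ 2 ≤ ∑ i, x i ^ 2 :=
    Finset.single_le_sum (f := fun i => x i ^ 2) (fun i _ => sq_nonneg (x i)) (Finset.mem_univ i)
  rw [Real.norm_eq_abs]
  nlinarith [sq_abs (x i), sq_nonneg (|x i| - 1), abs_nonneg (x i)]

/-- Near the level `t`, the graph of `F` is the only sheet of `P = 0` on which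
`P_y` is bounded away from zero. -/
theorem exists_tube_width {n : ℕ} (P : MvPolynomial (Fin (n + 1)) ℝ) {B : Set (Fin n → ℝ)}
    (hB : IsCompact B) (F : (Fin n → ℝ) → ℝ)
    (hroot : ∀ x ∈ B, evalAt P x (F x) = 0) (t : ℝ) {r : ℝ} (hr : 0 < r) :
    ∃ w > 0, ∀ x ∈ B, |F x - t| ≤ w →
      r ≤ |evalAt (pderiv (Fin.last n) P) x t| →
      evalAt P x t = 0 → F x = t := by
  have hcpt : IsCompact (B ×ˢ Set.Icc (t - 1) (t + 1)) := hB.prod isCompact_Icc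
  have huc := hcpt.uniformContinuousOn_of_continuous
    (continuous_evalAt (pderiv (Fin.last n) P)).continuousOn
  obtain ⟨w, hw, hw'⟩ := Metric.uniformContinuousOn_iff.1 huc r hr
  refine ⟨min (w / 2) 1, by positivity, fun x hx hxw hPy hP => ?_⟩
  by_contra hne
  have hex : ∃ s ∈ Set.uIcc t (F x), evalAt (pderiv (Fin.last n) P) x s = 0 := by
    have hd := hasDerivAt_evalAt P x
    have hc : Continuous fun s => evalAt P x s :=
      (continuous_evalAt P).comp (by fun_prop : Continuous fun s : ℝ => (x, s))
    rcases lt_or_gt_of_ne hne with h | h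
    · obtain ⟨s, hs, hs'⟩ := exists_hasDerivAt_eq_zero
        (f := fun s => evalAt P x s) h hc.continuousOn
        (by rw [hroot x hx, hP]) (fun s _ => hd s)
      exact ⟨s, by rw [Set.uIcc_of_ge h.le]; exact ⟨hs.1.le, hs.2.le⟩, hs'⟩
    · obtain ⟨s, hs, hs'⟩ := exists_hasDerivAt_eq_zero
        (f := fun s => evalAt P x s) h hc.continuousOn
        (by rw [hroot x hx, hP]) (fun s _ => hd s)
      exact ⟨s, by rw [Set.uIcc_of_le h.le]; exact ⟨hs.1.le, hs.2.le⟩, hs'⟩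
  obtain ⟨s, hs, hs0⟩ := hex
  have h1 : |s - t| ≤ |F x - t| := Set.abs_sub_left_of_mem_uIcc hs
  have h2 : |s - t| ≤ w / 2 := (h1.trans hxw).trans (min_le_left _ _)
  have h3 : |s - t| ≤ 1 := (h1.trans hxw).trans (min_le_right _ _)
  have h4 := abs_le.1 h3
  have h5 := hw' (x, t) ⟨hx, by constructor <;> linarith⟩ (x, s) ⟨hx, by constructor <;> linarith⟩
    (by rw [Prod.dist_eq]; simp only [dist_self, Real.dist_eq, abs_sub_comm t s]
        exact max_lt hw (by linarith))
  simp only [hs0, Real.dist_eq, sub_zero] at h5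
  linarith

theorem continuous_init {n : ℕ} : Continuous fun z : Fin (n + 1) → ℝ => Fin.init z :=
  continuous_pi fun i => continuous_apply (Fin.castSucc i)

theorem continuous_evalAt_init {n : ℕ} (p : MvPolynomial (Fin (n + 1)) ℝ) (t : ℝ) :
    Continuous fun z : Fin (n + 1) → ℝ => evalAt p (Fin.init z) t :=
  (continuous_evalAt p).comp (continuous_init.prodMk continuous_const)

theorem continuous_gradEnergy {n : ℕ} (P : MvPolynomial (Fin (n + 1)) ℝ) (t σ : ℝ) :
    Continuous (gradEnergy P t σ) := by
  rw [gradEnergy_eq]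
  have := fun i : Fin n => continuous_evalAt_init (pderiv i.castSucc P) t
  fun_prop

theorem continuous_constraintEnergy {n : ℕ} (P : MvPolynomial (Fin (n + 1)) ℝ) (δ t : ℝ) :
    Continuous (constraintEnergy P δ t) := by
  rw [constraintEnergy_eq]
  have := continuous_evalAt_init (pderiv (Fin.last n) P) t
  have := continuous_evalAt_init P t
  have := fun i : Fin n => (continuous_apply i).comp (continuous_init (n := n))
  simp only [Function.comp_def] at this
  fun_prop

end ComparisonPoint

section ComparisonLimit
open MvPolynomial Filter Topology

theorem isLocalMin_of_isMinOn_interior {X : Type*} [TopologicalSpace X] {f : X → ℝ} {K : Set X}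
    {z : X} (h : IsMinOn f K z) (hz : z ∈ interior K) : IsLocalMin f z :=
  h.isLocalMin (mem_interior_iff_mem_nhds.1 hz)

theorem constraint_bounds {δ u p w L : ℝ} (hδ : 0 < δ) (hw0 : 0 ≤ w) (hw : w ≤ δ ^ 2)
    (h : u * p * w = 1) (hL : 0 < L) (hu : |u| < L) :
    0 < w ∧ 1 / (2 * L * δ ^ 2) < |p| := by
  have hwpos : 0 < w := lt_of_le_of_ne hw0 (by rintro rfl; simp at h)
  refine ⟨hwpos, ?_⟩
  have h1 : |u| * |p| * w = 1 := by
    rw [← abs_of_pos hwpos, ← abs_mul, ← abs_mul, h, abs_one]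
  have hp : 0 < |p| := by
    rcases (abs_nonneg p).eq_or_lt with h0 | h0
    · rw [← h0] at h1; simp at h1
    · exact h0
  rw [div_lt_iff₀ (by positivity)]
  have h2 : |u| * |p| * w ≤ L * |p| * δ ^ 2 := by
    gcongr
  nlinarith [mul_pos (mul_pos hL hp) (pow_pos hδ 2)]

theorem exists_init_eq_and_last_eq {n : ℕ} (x : Fin n → ℝ) (u : ℝ) :
    ∃ z : Fin (n + 1) → ℝ, Fin.init z = x ∧ z (Fin.last n) = u :=
  ⟨fun i => Fin.lastCases (motive := fun _ => ℝ) u x i, by funext i; simp [Fin.init], by simp⟩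

theorem exists_minimizing_sequence {n : ℕ} (P : MvPolynomial (Fin (n + 1)) ℝ) {δ : ℝ} (hδ : 0 < δ)
    (F : (Fin n → ℝ) → ℝ) (D : Fin n → (Fin n → ℝ) → ℝ)
    (hF : ContinuousOn F {x | ∑ i, x i ^ 2 ≤ δ ^ 2})
    (hroot : ∀ x, ∑ i, x i ^ 2 ≤ δ ^ 2 → evalAt P x (F x) = 0)
    (hchain : ∀ x, ∑ i, x i ^ 2 ≤ δ ^ 2 → ∀ i : Fin n,
      evalAt (pderiv i.castSucc P) x (F x) + D i x * evalAt (pderiv (Fin.last n) P) x (F x) = 0)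
    (x₀ : Fin n → ℝ) (hx₀ : ∑ i, x₀ i ^ 2 ≤ δ ^ 2 / 4)
    (hPy : evalAt (pderiv (Fin.last n) P) x₀ (F x₀) ≠ 0) (m : ℕ) {σ : ℝ} (hσ : 0 < σ) :
    ∃ (η : ℕ → ℝ) (z : ℕ → Fin (n + 1) → ℝ) (zb : Fin (n + 1) → ℝ),
      (∀ l, η l ≠ 0) ∧ Tendsto η atTop (𝓝 0) ∧
      (∀ l, IsLocalMin (totalEnergy P δ m (F x₀) σ (η l)) (z l)) ∧ Tendsto z atTop (𝓝 zb) ∧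
      ∑ i, Fin.init zb i ^ 2 ≤ δ ^ 2 ∧ F (Fin.init zb) = F x₀ ∧
      ∑ i, D i (Fin.init zb) ^ 2 ≤ 16 / 9 * (∑ i, D i x₀ ^ 2 +
        σ / evalAt (pderiv (Fin.last n) P) x₀ (F x₀) ^ 2) := by
  set t := F x₀ with ht
  set p₀ := evalAt (pderiv (Fin.last n) P) x₀ t with hp₀
  set w₀ := δ ^ 2 - ∑ i, x₀ i ^ 2 with hw₀
  have hδ2 : 0 < δ ^ 2 := by positivity
  have hw₀pos : 3 / 4 * δ ^ 2 ≤ w₀ := by linarith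
  have hw₀pos' : 0 < w₀ := by linarith
  have hx₀B : ∑ i, x₀ i ^ 2 ≤ δ ^ 2 := by linarith
  set u₀ := 1 / (p₀ * w₀) with hu₀
  have hup : u₀ * p₀ * w₀ = 1 := by rw [hu₀]; field_simp
  have hu₀ne : u₀ ≠ 0 := by rintro h; rw [h] at hup; simp at hup
  obtain ⟨z₀, hz₀i, hz₀l⟩ := exists_init_eq_and_last_eq x₀ u₀
  obtain ⟨B₀, hB₀⟩ : ∃ B₀, B₀ = gradEnergy P t σ z₀ := ⟨_, rfl⟩
  have hB₀' : B₀ = u₀ ^ 2 * (∑ i : Fin n, evalAt (pderiv (Fin.castSucc i) P) x₀ t ^ 2 + σ) := by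
    rw [hB₀, gradEnergy_eq]; simp only [hz₀i, hz₀l]
  set L := √(B₀ / σ) + 1 with hL
  have hL1 : 0 < L := by positivity
  have hE₀ : constraintEnergy P δ t z₀ = 0 := by
    rw [constraintEnergy_eq]
    simp only [hz₀i, hz₀l]
    rw [ht, hroot x₀ hx₀B, ← ht, ← hp₀, ← hw₀, hup]
    ring
  have hub : ∀ z, gradEnergy P t σ z ≤ B₀ → |z (Fin.last n)| < L := by
    intro z hz
    have h1 : z (Fin.last n) ^ 2 * σ ≤ B₀ := by
      refine le_trans ?_ hz
      rw [gradEnergy_eq]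
      have : 0 ≤ ∑ i : Fin n, evalAt (pderiv (Fin.castSucc i) P) (Fin.init z) t ^ 2 :=
        Finset.sum_nonneg fun i _ => sq_nonneg _
      simp only
      nlinarith [sq_nonneg (z (Fin.last n))]
    have h2 : |z (Fin.last n)| ≤ √(B₀ / σ) := by
      refine Real.abs_le_sqrt ?_
      rw [le_div_iff₀ hσ]; exact h1
    linarith
  have hE : ∀ z, constraintEnergy P δ t z = 0 → evalAt P (Fin.init z) t = 0 ∧
      z (Fin.last n) * evalAt (pderiv (Fin.last n) P) (Fin.init z) t *
        (δ ^ 2 - ∑ i : Fin n, Fin.init z i ^ 2) = 1 := by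
    intro z hz
    rw [constraintEnergy_eq] at hz
    simp only at hz
    constructor
    · nlinarith [sq_nonneg (evalAt P (Fin.init z) t), sq_nonneg (z (Fin.last n) *
        evalAt (pderiv (Fin.last n) P) (Fin.init z) t *
        (δ ^ 2 - ∑ i : Fin n, Fin.init z i ^ 2) - 1)]
    · have := sq_nonneg (evalAt P (Fin.init z) t)
      have h2 : (z (Fin.last n) * evalAt (pderiv (Fin.last n) P) (Fin.init z) t *
        (δ ^ 2 - ∑ i : Fin n, Fin.init z i ^ 2) - 1) ^ 2 = 0 := le_antisymm (by linarith)
          (sq_nonneg _)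
      have := pow_eq_zero_iff (two_ne_zero) |>.1 h2
      linarith
  set r := 1 / (2 * L * δ ^ 2) with hr
  have hrpos : 0 < r := by positivity
  obtain ⟨w, hw, hwF⟩ := exists_tube_width P (isCompact_sum_sq_le (n := n) (δ ^ 2)) F hroot t hrpos
  let B : Set (Fin n → ℝ) := {x | ∑ i, x i ^ 2 ≤ δ ^ 2}
  let K : Set (Fin (n + 1) → ℝ) := {z | Fin.init z ∈ B ∩ F ⁻¹' Metric.closedBall t w} ∩
    ({z | r ≤ |evalAt (pderiv (Fin.last n) P) (Fin.init z) t|} ∩ {z | |z (Fin.last n)| ≤ L})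
  have hBc : IsCompact B := isCompact_sum_sq_le (n := n) (δ ^ 2)
  have hpy := continuous_evalAt_init (pderiv (Fin.last n) P) t
  have hKc : IsCompact K := by
    refine Metric.isCompact_of_isClosed_isBounded ?_ ?_
    · refine IsClosed.inter ?_ (IsClosed.inter ?_ ?_)
      · exact (hF.preimage_isClosed_of_isClosed hBc.isClosed Metric.isClosed_closedBall).preimage
          continuous_init
      · exact isClosed_le continuous_const hpy.abs
      · exact isClosed_le (continuous_apply _).abs continuous_const
    · obtain ⟨R, hR⟩ := hBc.isBounded.exists_norm_le
      refine (Metric.isBounded_closedBall (x := (0 : Fin (n + 1) → ℝ)) (r := max |R| L)).subset ?_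
      intro z hz
      rw [mem_closedBall_zero_iff]
      refine (pi_norm_le_iff_of_nonneg (by positivity)).2 fun i => ?_
      refine Fin.lastCases ?_ (fun i => ?_) i
      · exact le_max_of_le_right hz.2.2
      · exact le_max_of_le_left ((norm_le_pi_norm (Fin.init z) i).trans
          ((hR _ hz.1.1).trans (le_abs_self R)))
  have hlevel : ∀ z, z ∈ K → constraintEnergy P δ t z = 0 → F (Fin.init z) = t := fun z hz hz0 =>
    hwF _ hz.1.1 (by simpa [Real.dist_eq] using hz.1.2) hz.2.1 (hE z hz0).1
  have hz₀K : z₀ ∈ K := by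
    have h1 := hub z₀ hB₀.ge
    have h2 := (hE z₀ hE₀).2
    rw [hz₀i, ← hp₀, ← hw₀] at h2
    refine ⟨⟨by rw [hz₀i]; exact hx₀B, ?_⟩, ?_, h1.le⟩
    · rw [hz₀i]; simp [← ht, hw.le]
    · have := (constraint_bounds hδ hw₀pos'.le (by
        have : 0 ≤ ∑ i, x₀ i ^ 2 := Finset.sum_nonneg fun i _ => sq_nonneg _
        linarith) h2 hL1 h1).2
      rw [Set.mem_ofPred_eq, hz₀i]
      exact this.le
  have hinside : ∀ z ∈ K, constraintEnergy P δ t z = 0 → gradEnergy P t σ z ≤ B₀ → z ∈ interior K := by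
    intro z hz hz0 hzB
    have h1 := hub z hzB
    have h2 := (hE z hz0).2
    have h3 := constraint_bounds hδ (sub_nonneg.2 hz.1.1) (by
        have : 0 ≤ ∑ i, Fin.init z i ^ 2 := Finset.sum_nonneg fun i _ => sq_nonneg _
        linarith) h2 hL1 h1
    have h4 := hlevel z hz hz0
    have hBn : B ∈ 𝓝 (Fin.init z) := by
      have hcs : Continuous fun x : Fin n → ℝ => ∑ i, x i ^ 2 := by fun_prop
      filter_upwards [hcs.continuousAt.eventually_lt continuousAt_const (sub_pos.1 h3.1)] with x hx
      exact hx.le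
    have hFc : ContinuousAt F (Fin.init z) := hF.continuousAt hBn
    rw [mem_interior_iff_mem_nhds]
    refine Filter.inter_mem ?_ (Filter.inter_mem ?_ ?_)
    · refine continuous_init.continuousAt.preimage_mem_nhds (Filter.inter_mem hBn ?_)
      refine hFc.preimage_mem_nhds ?_
      rw [h4]; exact Metric.closedBall_mem_nhds _ hw
    · filter_upwards [continuousAt_const.eventually_lt hpy.abs.continuousAt h3.2] with x hx
      exact hx.le
    · filter_upwards [(continuous_apply (Fin.last n)).abs.continuousAt.eventually_lt
        continuousAt_const h1] with x hx
      exact hx.le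
  obtain ⟨η, z, zb, hη, hη0, hzK, hmin, hz, hzbK, hzbE, hzbh⟩ :=
    exists_penalized_minimizers hKc hz₀K (h := gradEnergy P t σ) (E := constraintEnergy P δ t)
      (q := fun z => ∑ v, z v ^ (m + 1)) (continuous_gradEnergy P t σ).continuousOn
      (continuous_constraintEnergy P δ t).continuousOn (by fun_prop)
      (fun z _ => by rw [constraintEnergy_eq]; exact add_nonneg (sq_nonneg _) (sq_nonneg _)) hE₀
      (by rw [← hB₀]; exact hinside)
  have hFzb := hlevel zb hzbK hzbE
  refine ⟨η, z, zb, fun l => (hη l).ne', hη0, fun l =>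
    isLocalMin_of_isMinOn_interior (hmin l) (hzK l), hz, hzbK.1.1, hFzb, ?_⟩
  have hub' := (hE zb hzbE).2
  set xb := Fin.init zb with hxb
  have hxbB : ∑ i, xb i ^ 2 ≤ δ ^ 2 := hzbK.1.1
  set pb := evalAt (pderiv (Fin.last n) P) xb t with hpb
  set wb := δ ^ 2 - ∑ i, xb i ^ 2 with hwb
  have hwbpos : 0 ≤ wb := sub_nonneg.2 hxbB
  have hwble : wb ≤ δ ^ 2 := by
    have : 0 ≤ ∑ i, xb i ^ 2 := Finset.sum_nonneg fun i _ => sq_nonneg _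
    linarith
  set ub := zb (Fin.last n) with hubd
  have e1 : ∀ x, ∑ i, x i ^ 2 ≤ δ ^ 2 → F x = t →
      ∑ i : Fin n, evalAt (pderiv (Fin.castSucc i) P) x t ^ 2 =
        (∑ i, D i x ^ 2) * evalAt (pderiv (Fin.last n) P) x t ^ 2 := by
    intro x hx hxt
    rw [Finset.sum_mul]
    refine Finset.sum_congr rfl fun i _ => ?_
    have := hchain x hx i
    rw [hxt] at this
    rw [eq_neg_of_add_eq_zero_left this]; ring
  have e2 : gradEnergy P t σ zb = ub ^ 2 * ((∑ i, D i xb ^ 2) * pb ^ 2 + σ) := by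
    rw [gradEnergy_eq]
    simp only
    rw [← hxb, e1 xb hxbB hFzb]
  rw [← hB₀, e2, hB₀', e1 x₀ hx₀B rfl, ← hp₀] at hzbh
  set Sb := ∑ i, D i xb ^ 2 with hSb
  set S₀ := ∑ i, D i x₀ ^ 2 with hS₀
  have hSb0 : 0 ≤ Sb := Finset.sum_nonneg fun i _ => sq_nonneg _
  have hS₀0 : 0 ≤ S₀ := Finset.sum_nonneg fun i _ => sq_nonneg _
  have hp2 : 0 < p₀ ^ 2 := by positivity
  have f1 : (u₀ * p₀) ^ 2 * (S₀ + σ / p₀ ^ 2) = u₀ ^ 2 * (S₀ * p₀ ^ 2 + σ) := by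
    field_simp
  have f2 : (ub * pb) ^ 2 * Sb ≤ (u₀ * p₀) ^ 2 * (S₀ + σ / p₀ ^ 2) := by
    rw [f1]; nlinarith [mul_nonneg (sq_nonneg ub) hσ.le]
  have g1 : (u₀ * p₀) ^ 2 * w₀ ^ 2 = 1 := by rw [← mul_pow, hup, one_pow]
  have g2 : (ub * pb) ^ 2 * wb ^ 2 = 1 := by rw [← mul_pow, hub', one_pow]
  have g3 : (u₀ * p₀) ^ 2 * (3 / 4 * δ ^ 2) ^ 2 ≤ 1 := by
    rw [← g1]; gcongr
  have g4 : 1 ≤ (ub * pb) ^ 2 * (δ ^ 2) ^ 2 := by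
    rw [← g2]; gcongr
  have hT : 0 ≤ S₀ + σ / p₀ ^ 2 := by positivity
  calc Sb = 1 * Sb := (one_mul _).symm
    _ ≤ ((ub * pb) ^ 2 * (δ ^ 2) ^ 2) * Sb := by gcongr
    _ = (δ ^ 2) ^ 2 * ((ub * pb) ^ 2 * Sb) := by ring
    _ ≤ (δ ^ 2) ^ 2 * ((u₀ * p₀) ^ 2 * (S₀ + σ / p₀ ^ 2)) := by gcongr
    _ = 16 / 9 * (((u₀ * p₀) ^ 2 * (3 / 4 * δ ^ 2) ^ 2) * (S₀ + σ / p₀ ^ 2)) := by ring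
    _ ≤ 16 / 9 * (1 * (S₀ + σ / p₀ ^ 2)) := by gcongr
    _ = _ := by rw [one_mul]

end ComparisonLimit

section ComparisonRelations
open MvPolynomial Filter Topology

theorem exists_comparison_relations {n : ℕ} (P : MvPolynomial (Fin (n + 1)) ℝ)
    (hP : 1 ≤ P.totalDegree) {δ : ℝ} (hδ : 0 < δ) :
    ∃ c : MvPolynomial (Fin (n + 1)) ℝ →
        Fin ((2 * P.totalDegree + 4) ^ (n + 1) + 1) → Polynomial ℝ, (∀ Y, ∃ i, c Y i ≠ 0) ∧
      ∀ (F : (Fin n → ℝ) → ℝ) (D : Fin n → (Fin n → ℝ) → ℝ),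
        ContinuousOn F {x | ∑ i, x i ^ 2 ≤ δ ^ 2} →
        (∀ i, ContinuousOn (D i) {x | ∑ i, x i ^ 2 ≤ δ ^ 2}) →
        (∀ x, ∑ i, x i ^ 2 ≤ δ ^ 2 → evalAt P x (F x) = 0) →
        (∀ x, ∑ i, x i ^ 2 ≤ δ ^ 2 → ∀ i : Fin n, evalAt (pderiv i.castSucc P) x (F x) +
          D i x * evalAt (pderiv (Fin.last n) P) x (F x) = 0) →
        ∀ x₀ : Fin n → ℝ, ∑ i, x₀ i ^ 2 ≤ δ ^ 2 / 4 →
        evalAt (pderiv (Fin.last n) P) x₀ (F x₀) ≠ 0 →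
        ∃ x : Fin n → ℝ, ∑ i, x i ^ 2 ≤ δ ^ 2 ∧ F x = F x₀ ∧
          ∑ i, D i x ^ 2 ≤ 16 / 9 * ∑ i, D i x₀ ^ 2 ∧
          ∀ Y, ∑ i, (c Y i).eval (F x₀) * evalAt Y x (F x₀) ^ (i : ℕ) = 0 := by
  choose c hc hrel using exists_critical_relation P hP δ
  refine ⟨c, hc, fun F D hF hD hroot hchain x₀ hx₀ hPy => ?_⟩
  have hσpos : ∀ j : ℕ, 0 < 1 / ((j : ℝ) + 1) := fun j => by positivity
  choose η z zb hη hη0 hmin hz hzB hzF hzD using fun j : ℕ =>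
    exists_minimizing_sequence P hδ F D hF hroot hchain x₀ hx₀ hPy
      (2 * P.totalDegree + 4) (hσpos j)
  obtain ⟨x, hx, ψ, hψ, hlim⟩ := (isCompact_sum_sq_le (n := n) (δ ^ 2)).tendsto_subseq hzB
  have hσ0 : Tendsto (fun j : ℕ => 1 / ((j : ℝ) + 1)) atTop (𝓝 0) :=
    tendsto_one_div_add_atTop_nhds_zero_nat
  have hlimB : Tendsto (fun j => Fin.init (zb (ψ j))) atTop
      (𝓝[{x | ∑ i, x i ^ 2 ≤ δ ^ 2}] x) :=
    tendsto_nhdsWithin_iff.2 ⟨hlim, Eventually.of_forall fun j => hzB _⟩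
  refine ⟨x, hx, ?_, ?_, fun Y => ?_⟩
  · refine tendsto_nhds_unique ((hF x hx).tendsto.comp hlimB) ?_
    simp only [Function.comp_def, hzF]
    exact tendsto_const_nhds
  · have h1 : Tendsto (fun j => ∑ i, D i (Fin.init (zb (ψ j))) ^ 2) atTop (𝓝 (∑ i, D i x ^ 2)) :=
      tendsto_finsetSum _ fun i _ => ((hD i x hx).tendsto.comp hlimB).pow 2
    have h2 := (((hσ0.comp hψ.tendsto_atTop).div_const
      (evalAt (pderiv (Fin.last n) P) x₀ (F x₀) ^ 2)).const_add (∑ i, D i x₀ ^ 2)).const_mul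
        (16 / 9 : ℝ)
    have h3 := le_of_tendsto_of_tendsto h1 h2 (Eventually.of_forall fun j => hzD (ψ j))
    simpa using h3
  · have h := hrel Y (F x₀) (fun j => 1 / ((ψ j : ℝ) + 1)) (fun j => η (ψ j)) (fun j => z (ψ j))
      (fun j => zb (ψ j)) x (fun j => (hσpos _).ne') (hσ0.comp hψ.tendsto_atTop)
      (fun j => hη _) (fun j => hη0 _) (fun j => hmin _) (fun j => hz _) hlim
    unfold evalAt
    exact h

end ComparisonRelations

section NewtonExponents
open Filter Topology Asymptotics

theorem exists_comparable_terms {ι κ : Type*} [Fintype κ] (l : Ultrafilter ι) (T : κ → ι → ℝ)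
    (hsum : ∀ᶠ j in l, ∑ i, T i j = 0) (i₀ : κ) (hne : ∀ᶠ j in l, T i₀ j ≠ 0) :
    ∃ a b, a ≠ b ∧ (∀ᶠ j in l, T a j ≠ 0) ∧ (∀ᶠ j in l, T b j ≠ 0) ∧ T a =Θ[l] T b := by
  classical
  have : Nonempty κ := ⟨i₀⟩
  obtain ⟨a, ha⟩ : ∃ a, ∀ᶠ j in l, ∀ i, |T i j| ≤ |T a j| :=
    Ultrafilter.eventually_exists_iff.1 (Eventually.of_forall fun j =>
      Finite.exists_max fun i => |T i j|)
  have hane : ∀ᶠ j in l, T a j ≠ 0 := by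
    filter_upwards [ha, hne] with j hj hj0 h0
    have := hj i₀
    rw [h0, abs_zero] at this
    exact hj0 (abs_nonpos_iff.1 this)
  obtain ⟨b, hb⟩ : ∃ b, ∀ᶠ j in l, b ≠ a ∧ ∀ i, i ≠ a → |T i j| ≤ |T b j| := by
    refine Ultrafilter.eventually_exists_iff.1 ?_
    filter_upwards [hsum, hane] with j hj hj0
    have hnonempty : (Finset.univ.erase a).Nonempty := by
      by_contra hemp
      rw [Finset.not_nonempty_iff_eq_empty] at hemp
      rw [← Finset.add_sum_erase _ _ (Finset.mem_univ a), hemp] at hj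
      exact hj0 (by simpa using hj)
    obtain ⟨b, hb, hmax⟩ := Finset.exists_max_image _ (fun i => |T i j|) hnonempty
    exact ⟨b, Finset.ne_of_mem_erase hb, fun i hi =>
      hmax i (Finset.mem_erase.2 ⟨hi, Finset.mem_univ _⟩)⟩
  have hbound : ∀ᶠ j in l, |T a j| ≤ Fintype.card κ * |T b j| := by
    filter_upwards [hsum, hb] with j hj hbj
    rw [← Finset.add_sum_erase _ _ (Finset.mem_univ a)] at hj
    rw [eq_neg_of_add_eq_zero_left hj, abs_neg]
    refine (Finset.abs_sum_le_sum_abs _ _).trans ?_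
    refine (Finset.sum_le_card_nsmul _ _ |T b j| fun i hi =>
      hbj.2 i (Finset.ne_of_mem_erase hi)).trans ?_
    rw [nsmul_eq_mul]
    gcongr
    exact Finset.card_le_univ _
  refine ⟨a, b, ?_, hane, ?_, ?_, ?_⟩
  · obtain ⟨j, hj⟩ := hb.exists
    exact hj.1.symm
  · filter_upwards [hbound, hane] with j hj hj0 h0
    rw [h0, abs_zero, mul_zero] at hj
    exact hj0 (abs_nonpos_iff.1 hj)
  · exact IsBigO.of_bound _ hbound
  · refine IsBigO.of_bound 1 ?_
    filter_upwards [ha] with j hj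
    simpa using hj b

theorem isTheta_one_of_tendsto {ι : Type*} {l : Filter ι} {g : ι → ℝ} {L : ℝ}
    (hg : Tendsto g l (𝓝 L)) (hL : L ≠ 0) : g =Θ[l] fun _ => (1 : ℝ) := by
  refine IsTheta.symm (isTheta_of_div_tendsto_nhds_ne_zero (c := L) ?_ hL)
  simpa [Pi.div_def] using hg

theorem eval_isTheta_pow {ι : Type*} {l : Filter ι} {t : ι → ℝ} (ht : Tendsto t l (𝓝 0))
    {c : Polynomial ℝ} (hc : c ≠ 0) : ∃ m : ℕ, (fun j => c.eval (t j)) =Θ[l] fun j => t j ^ m := by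
  obtain ⟨m, c', hc', u, h0⟩ := exists_common_X_pow_factor (fun _ : Unit => c) ⟨(), hc⟩
  refine ⟨m, ?_⟩
  have h1 : Tendsto (fun j => (c' ()).eval (t j)) l (𝓝 ((c' ()).coeff 0)) := by
    have := ((c' ()).continuous.tendsto 0).comp ht
    rwa [← Polynomial.coeff_zero_eq_eval_zero] at this
  have h2 : (fun j => (c' ()).eval (t j)) =Θ[l] fun _ => (1 : ℝ) := isTheta_one_of_tendsto h1 h0
  have h3 := (isTheta_refl (fun j => t j ^ m) l).mul h2
  simp only [mul_one] at h3
  simp only [hc' (), Polynomial.eval_mul, Polynomial.eval_pow, Polynomial.eval_X]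
  exact h3

/-- The Newton polygon estimate: a function satisfying a polynomial equation over `ℝ[t]` is
either zero or comparable to a fractional power of `t`. -/
theorem newton_exponent {ι : Type*} (l : Ultrafilter ι) {t y : ι → ℝ} (ht : Tendsto t l (𝓝 0))
    (ht0 : ∀ᶠ j in l, t j ≠ 0) {M : ℕ} (c : Fin (M + 1) → Polynomial ℝ) (hc : ∃ i, c i ≠ 0)
    (hrel : ∀ᶠ j in l, ∑ i, (c i).eval (t j) * y j ^ (i : ℕ) = 0) (hy : ∀ᶠ j in l, y j ≠ 0) :
    ∃ (q : ℕ) (p : ℤ), 1 ≤ q ∧ q ≤ M ∧ (fun j => y j ^ q) =Θ[l] fun j => t j ^ p := by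
  obtain ⟨i₀, hi₀⟩ := hc
  have hevne : ∀ c : Polynomial ℝ, c ≠ 0 → ∀ᶠ j in l, c.eval (t j) ≠ 0 := by
    intro c hc
    obtain ⟨m, hm⟩ := eval_isTheta_pow ht hc
    filter_upwards [hm.eq_zero_iff, ht0] with j hj hj0 h
    exact pow_ne_zero m hj0 (hj.1 h)
  obtain ⟨a, b, hab, ha, hb, hθ⟩ := exists_comparable_terms l
    (fun (i : Fin (M + 1)) j => (c i).eval (t j) * y j ^ (i : ℕ)) hrel i₀ (by
      filter_upwards [hevne _ hi₀, hy] with j h1 h2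
      exact mul_ne_zero h1 (pow_ne_zero _ h2))
  wlog hlt : a < b generalizing a b
  · exact this b a hab.symm hb ha hθ.symm (lt_of_le_of_ne (not_lt.1 hlt) hab.symm)
  have hca : c a ≠ 0 := by
    rintro h; obtain ⟨j, hj⟩ := ha.exists; simp [h] at hj
  have hcb : c b ≠ 0 := by
    rintro h; obtain ⟨j, hj⟩ := hb.exists; simp [h] at hj
  obtain ⟨ma, hma⟩ := eval_isTheta_pow ht hca
  obtain ⟨mb, hmb⟩ := eval_isTheta_pow ht hcb
  have hlt' : (a : ℕ) < b := hlt
  refine ⟨b - a, (ma : ℤ) - mb, by omega, by omega, ?_⟩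
  have h1 : (fun j => t j ^ mb * y j ^ (b : ℕ)) =Θ[l] fun j => t j ^ ma * y j ^ (a : ℕ) :=
    ((hmb.symm.mul (isTheta_refl _ _)).trans hθ.symm).trans (hma.mul (isTheta_refl _ _))
  have h2 := h1.div (isTheta_refl (fun j => t j ^ mb * y j ^ (a : ℕ)) (l : Filter ι))
  refine (EventuallyEq.trans_isTheta ?_ h2).trans_eventuallyEq ?_
  · filter_upwards [hy, ht0] with j hj hj0
    rw [mul_div_mul_left _ _ (pow_ne_zero _ hj0), pow_sub₀ _ hj hlt'.le, div_eq_mul_inv]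
  · filter_upwards [hy, ht0] with j hj hj0
    rw [mul_div_mul_right _ _ (pow_ne_zero _ hj), zpow_sub₀ hj0, zpow_natCast, zpow_natCast]

end NewtonExponents

section ArcExpansion
open Filter Topology Asymptotics

theorem IsTheta.of_pow_ne_zero {ι : Type*} {l : Filter ι} {f g : ι → ℝ} {n : ℕ} (hn : n ≠ 0)
    (h : (fun j => f j ^ n) =Θ[l] fun j => g j ^ n) : f =Θ[l] g :=
  ⟨IsBigO.of_pow hn h.1, IsBigO.of_pow hn h.2⟩

theorem zpow_isTheta_injective {ι : Type*} {l : Filter ι} [l.NeBot] {t : ι → ℝ}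
    (ht : Tendsto t l (𝓝 0)) (ht0 : ∀ᶠ j in l, t j ≠ 0) {a b : ℤ}
    (h : (fun j => t j ^ a) =Θ[l] fun j => t j ^ b) : a = b := by
  wlog hab : a < b generalizing a b
  · rcases eq_or_lt_of_le (not_lt.1 hab) with h1 | h1
    · exact h1.symm
    · exact (this h.symm h1).symm
  exfalso
  obtain ⟨m, hm⟩ := Int.eq_ofNat_of_zero_le (sub_nonneg.2 hab.le)
  have h1 := h.div (isTheta_refl (fun j => t j ^ a) l)
  have h2 : (fun _ => (1 : ℝ)) =Θ[l] fun j => t j ^ m := by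
    refine (EventuallyEq.trans_isTheta ?_ h1).trans_eventuallyEq ?_
    · filter_upwards [ht0] with j hj
      rw [div_self (zpow_ne_zero _ hj)]
    · filter_upwards [ht0] with j hj
      rw [← zpow_sub₀ hj, hm, zpow_natCast]
  have hm0 : m ≠ 0 := by
    rintro rfl
    simp at hm
    omega
  have h3 : Tendsto (fun j => t j ^ m) l (𝓝 0) := by
    simpa [hm0] using ht.pow m
  have := h2.tendsto_zero_iff.2 h3
  simpa using tendsto_nhds_unique this tendsto_const_nhds

/-- A function that agrees along `l` with a quotient of two elements of `A`. -/
def IsQuotientAlong {ι : Type*} (l : Filter ι) (A : Subalgebra ℝ (ι → ℝ)) (q : ι → ℝ) : Prop :=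
  ∃ a ∈ A, ∃ b ∈ A, (∀ᶠ j in l, b j ≠ 0) ∧ ∀ᶠ j in l, q j = a j / b j

namespace IsQuotientAlong
variable {ι : Type*} {l : Filter ι} {A : Subalgebra ℝ (ι → ℝ)} {p q : ι → ℝ}

theorem of_mem (hq : q ∈ A) : IsQuotientAlong l A q :=
  ⟨q, hq, 1, A.one_mem, by simp, by simp⟩

theorem const (x : ℝ) : IsQuotientAlong l A fun _ => x :=
  of_mem (A.algebraMap_mem x)

theorem mul (hp : IsQuotientAlong l A p) (hq : IsQuotientAlong l A q) :
    IsQuotientAlong l A fun j => p j * q j := by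
  obtain ⟨a, ha, b, hb, hb0, h⟩ := hp
  obtain ⟨a', ha', b', hb', hb0', h'⟩ := hq
  refine ⟨a * a', A.mul_mem ha ha', b * b', A.mul_mem hb hb', ?_, ?_⟩
  · filter_upwards [hb0, hb0'] with j h1 h2
    exact mul_ne_zero h1 h2
  · filter_upwards [h, h'] with j h1 h2
    rw [h1, h2, div_mul_div_comm]
    rfl

theorem sub (hp : IsQuotientAlong l A p) (hq : IsQuotientAlong l A q) :
    IsQuotientAlong l A fun j => p j - q j := by
  obtain ⟨a, ha, b, hb, hb0, h⟩ := hp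
  obtain ⟨a', ha', b', hb', hb0', h'⟩ := hq
  refine ⟨a * b' - b * a', A.sub_mem (A.mul_mem ha hb') (A.mul_mem hb ha'), b * b',
    A.mul_mem hb hb', ?_, ?_⟩
  · filter_upwards [hb0, hb0'] with j h1 h2
    exact mul_ne_zero h1 h2
  · filter_upwards [h, h', hb0, hb0'] with j h1 h2 h3 h4
    rw [h1, h2, div_sub_div _ _ h3 h4]
    rfl

theorem inv (hp : IsQuotientAlong l A p) (hp0 : ∀ᶠ j in l, p j ≠ 0) :
    IsQuotientAlong l A fun j => (p j)⁻¹ := by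
  obtain ⟨a, ha, b, hb, hb0, h⟩ := hp
  refine ⟨b, hb, a, ha, ?_, ?_⟩
  · filter_upwards [h, hp0] with j h1 h2 h3
    rw [h3, zero_div] at h1
    exact h2 h1
  · filter_upwards [h] with j h1
    rw [h1, inv_div]

theorem exists_exponent {ι : Type*} {l : Ultrafilter ι} {A : Subalgebra ℝ (ι → ℝ)} {t q : ι → ℝ}
    {M : ℕ} (ht0 : ∀ᶠ j in l, t j ≠ 0)
    (hA : ∀ y ∈ A, (∀ᶠ j in l, y j ≠ 0) → ∃ (r : ℕ) (p : ℤ), 1 ≤ r ∧ r ≤ M ∧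
      (fun j => y j ^ r) =Θ[l] fun j => t j ^ p)
    (hq : IsQuotientAlong l A q) (hq0 : ∀ᶠ j in l, q j ≠ 0) :
    ∃ m : ℤ, (fun j => q j ^ M.factorial) =Θ[l] fun j => t j ^ m := by
  have key : ∀ y ∈ A, (∀ᶠ j in l, y j ≠ 0) →
      ∃ m : ℤ, (fun j => y j ^ M.factorial) =Θ[l] fun j => t j ^ m := by
    intro y hy hy0
    obtain ⟨r, p, hr, hrM, h⟩ := hA y hy hy0
    obtain ⟨s, hs⟩ := Nat.dvd_factorial hr hrM
    refine ⟨p * s, ?_⟩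
    simpa only [hs, pow_mul, zpow_mul, zpow_natCast] using h.pow s
  obtain ⟨a, ha, b, hb, hb0, h⟩ := hq
  have ha0 : ∀ᶠ j in l, a j ≠ 0 := by
    filter_upwards [h, hq0] with j h1 h2 h3
    rw [h3, zero_div] at h1
    exact h2 h1
  obtain ⟨m, hm⟩ := key a ha ha0
  obtain ⟨m', hm'⟩ := key b hb hb0
  refine ⟨m - m', (EventuallyEq.trans_isTheta ?_ (hm.div hm')).trans_eventuallyEq ?_⟩
  · filter_upwards [h] with j hj
    rw [hj, div_pow]
  · filter_upwards [ht0] with j hj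
    rw [zpow_sub₀ hj]

end IsQuotientAlong

variable {ι : Type*} {l : Ultrafilter ι} {A : Subalgebra ℝ (ι → ℝ)} {t : ι → ℝ} {M : ℕ}

/-- The value group is discrete: there is a uniformizer `π` whose powers are comparable to all
nonzero quotients, and whose `e`-th power is comparable to `t`. -/
theorem exists_uniformizer (ht0 : ∀ᶠ j in l, t j ≠ 0) (htA : t ∈ A)
    (hA : ∀ y ∈ A, (∀ᶠ j in l, y j ≠ 0) → ∃ (r : ℕ) (p : ℤ), 1 ≤ r ∧ r ≤ M ∧
      (fun j => y j ^ r) =Θ[l] fun j => t j ^ p) :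
    ∃ (e : ℕ) (u : ι → ℝ), 1 ≤ e ∧ IsQuotientAlong l A u ∧ (∀ᶠ j in l, u j ≠ 0) ∧
      ((fun j => u j ^ e) =Θ[l] t) ∧
      ∀ q, IsQuotientAlong l A q → (∀ᶠ j in l, q j ≠ 0) →
        ∃ i : ℤ, q =Θ[l] fun j => u j ^ i := by
  have hQ : M.factorial ≠ 0 := M.factorial_ne_zero
  let Γ : AddSubgroup ℤ :=
    { carrier := {m | ∃ q, IsQuotientAlong l A q ∧ (∀ᶠ j in l, q j ≠ 0) ∧
        (fun j => q j ^ M.factorial) =Θ[l] fun j => t j ^ m}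
      zero_mem' := ⟨fun _ => 1, .const 1, by simp, by simp⟩
      add_mem' := by
        rintro m m' ⟨q, hq, hq0, h⟩ ⟨q', hq', hq0', h'⟩
        refine ⟨_, hq.mul hq', ?_, ?_⟩
        · filter_upwards [hq0, hq0'] with j h1 h2
          exact mul_ne_zero h1 h2
        · simp only [mul_pow]
          refine (h.mul h').trans_eventuallyEq ?_
          filter_upwards [ht0] with j hj
          rw [zpow_add₀ hj]
      neg_mem' := by
        rintro m ⟨q, hq, hq0, h⟩
        refine ⟨_, hq.inv hq0, ?_, ?_⟩
        · filter_upwards [hq0] with j h1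
          exact inv_ne_zero h1
        · simpa only [inv_pow, zpow_neg] using h.inv }
  have hΓQ : (M.factorial : ℤ) ∈ Γ :=
    ⟨t, .of_mem htA, ht0, by simpa using isTheta_refl _ _⟩
  obtain ⟨g₀, hg₀⟩ := Int.subgroup_cyclic Γ
  rw [← AddSubgroup.zmultiples_eq_closure, ← Int.zmultiples_natAbs] at hg₀
  obtain ⟨g, hg⟩ : ∃ g : ℕ, g = g₀.natAbs := ⟨_, rfl⟩
  rw [← hg] at hg₀
  obtain ⟨u, hu, hu0, hug⟩ : (g : ℤ) ∈ Γ := by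
    rw [hg₀]; exact AddSubgroup.mem_zmultiples _
  obtain ⟨e, he⟩ : g ∣ M.factorial := by
    rw [hg₀, Int.mem_zmultiples_iff] at hΓQ
    exact_mod_cast hΓQ
  have hg0 : g ≠ 0 := by rintro rfl; simp at he; exact hQ he
  have he0 : e ≠ 0 := by rintro rfl; simp at he; exact hQ he
  refine ⟨e, u, Nat.one_le_iff_ne_zero.2 he0, hu, hu0, ?_, ?_⟩
  · refine IsTheta.of_pow_ne_zero hg0 ?_
    have : ∀ j, (u j ^ e) ^ g = u j ^ M.factorial := fun j => by rw [← pow_mul, he, mul_comm]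
    simpa only [this, zpow_natCast] using hug
  · intro q hq hq0
    obtain ⟨m, hm⟩ := hq.exists_exponent ht0 hA hq0
    have hmΓ : m ∈ Γ := ⟨q, hq, hq0, hm⟩
    rw [hg₀, Int.mem_zmultiples_iff] at hmΓ
    obtain ⟨i, rfl⟩ := hmΓ
    refine ⟨i, IsTheta.of_pow_ne_zero hQ (hm.trans ?_)⟩
    have : ∀ j, (u j ^ i) ^ M.factorial = (u j ^ M.factorial) ^ i := fun j => by
      rw [← zpow_natCast, ← zpow_natCast, ← zpow_mul, ← zpow_mul, mul_comm]
    simp only [this, zpow_mul]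
    exact (hug.zpow i).symm

theorem ramification_le
    (hA : ∀ y ∈ A, (∀ᶠ j in l, y j ≠ 0) → ∃ (r : ℕ) (p : ℤ), 1 ≤ r ∧ r ≤ M ∧
      (fun j => y j ^ r) =Θ[l] fun j => t j ^ p)
    {e : ℕ} {u : ι → ℝ} (he : 1 ≤ e) (hu : IsQuotientAlong l A u) (hu0 : ∀ᶠ j in l, u j ≠ 0)
    (hut : (fun j => u j ^ e) =Θ[l] t) (hulim : Tendsto u l (𝓝 0))
    (hval : ∀ q, IsQuotientAlong l A q → (∀ᶠ j in l, q j ≠ 0) →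
        ∃ i : ℤ, q =Θ[l] fun j => u j ^ i) : e ≤ M := by
  obtain ⟨a, ha, b, hb, hb0, hab⟩ := hu
  obtain ⟨i, hi⟩ := hval b (.of_mem hb) hb0
  have hy : (a * b ^ (e - 1)) =Θ[l] fun j => u j ^ (1 + i * e) := by
    have h1 := (isTheta_refl u (l : Filter ι)).mul (hi.pow e)
    refine (EventuallyEq.trans_isTheta ?_ h1).trans_eventuallyEq ?_
    · obtain ⟨e', rfl⟩ := Nat.exists_eq_add_of_le' he
      filter_upwards [hab, hb0] with j h1 h2
      rw [h1]
      simp only [Pi.mul_apply, Pi.pow_apply, Nat.add_sub_cancel, pow_succ]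
      field_simp
    · filter_upwards [hu0] with j h1
      rw [zpow_add₀ h1, zpow_one, zpow_mul, zpow_natCast]
  obtain ⟨r, p, hr, hrM, hrp⟩ := hA _ (A.mul_mem ha (A.pow_mem hb (e - 1))) (by
    filter_upwards [hy.eq_zero_iff, hu0] with j h1 h2 h3
    exact zpow_ne_zero _ h2 (h1.1 h3))
  have h2 : (fun j => u j ^ ((1 + i * e) * r)) =Θ[l] fun j => u j ^ (e * p) := by
    have h3 := ((hy.pow r).symm.trans hrp).trans (hut.zpow p).symm
    simpa only [zpow_mul, zpow_natCast] using h3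
  have h3 := zpow_isTheta_injective hulim hu0 h2
  have h4 : (e : ℤ) ∣ r := by
    refine ⟨p - i * r, ?_⟩
    linear_combination h3
  exact (Nat.le_of_dvd (by omega) (Int.natCast_dvd_natCast.1 h4)).trans hrM

theorem exists_polynomial_expansion {u : ι → ℝ} (hu : IsQuotientAlong l A u)
    (hu0 : ∀ᶠ j in l, u j ≠ 0) (hulim : Tendsto u l (𝓝 0))
    (hval : ∀ q, IsQuotientAlong l A q → (∀ᶠ j in l, q j ≠ 0) →
        ∃ i : ℤ, q =Θ[l] fun j => u j ^ i)
    (m : ℕ) : ∀ q, IsQuotientAlong l A q → (q =O[l] fun _ => (1 : ℝ)) →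
      ∃ p : Polynomial ℝ, (fun j => q j - p.eval (u j)) =O[l] fun j => u j ^ m := by
  induction m with
  | zero => exact fun q _ hb => ⟨0, by simpa using hb⟩
  | succ m ih =>
    intro q hq hb
    obtain ⟨L, hL⟩ : ∃ L, Tendsto q l (𝓝 L) := by
      obtain ⟨C, hC⟩ := hb.bound
      have hmem : ↑(l.map q) ≤ 𝓟 (Metric.closedBall (0 : ℝ) C) := by
        rw [le_principal_iff, Ultrafilter.mem_coe, Ultrafilter.mem_map]
        exact hC.mono fun j hj => by simpa using hj
      obtain ⟨L, -, hL⟩ := (isCompact_closedBall (0 : ℝ) C).ultrafilter_le_nhds _ hmem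
      exact ⟨L, hL⟩
    rcases l.em (fun j => q j - L = 0) with h0 | h0
    · refine ⟨Polynomial.C L, EventuallyEq.trans_isBigO (f₂ := fun _ => (0 : ℝ)) ?_
        (isBigO_zero _ _)⟩
      filter_upwards [h0] with j hj
      simpa using hj
    · have hqL : IsQuotientAlong l A fun j => q j - L := hq.sub (.const L)
      obtain ⟨i, hi⟩ := hval _ hqL h0
      have hdiv : (fun j => (q j - L) * (u j)⁻¹) =Θ[l] fun j => u j ^ (i - 1) := by
        refine (hi.mul (isTheta_refl _ _)).trans_eventuallyEq ?_
        filter_upwards [hu0] with j hj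
        rw [zpow_sub_one₀ hj]
      have hi1 : 1 ≤ i := by
        by_contra hlt
        obtain ⟨s, hs⟩ := Int.eq_ofNat_of_zero_le (show 0 ≤ -i by omega)
        have h1 : Tendsto (fun j => u j ^ i) l (𝓝 0) := hi.tendsto_zero_iff.1 (by
          simpa using hL.sub_const L)
        have h2 := h1.mul (hulim.pow s)
        rw [zero_mul] at h2
        have h3 : Tendsto (fun _ : ι => (1 : ℝ)) l (𝓝 0) := by
          refine h2.congr' ?_
          filter_upwards [hu0] with j hj
          rw [← zpow_natCast, ← zpow_add₀ hj, show i + (s : ℤ) = 0 by omega, zpow_zero]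
        exact one_ne_zero (tendsto_nhds_unique tendsto_const_nhds h3)
      obtain ⟨s, hs⟩ := Int.eq_ofNat_of_zero_le (show 0 ≤ i - 1 by omega)
      obtain ⟨p, hp⟩ := ih _ (hqL.mul (hu.inv hu0)) (hdiv.1.trans (by
        rw [hs]
        simp only [zpow_natCast]
        simpa using (hulim.isBigO_one ℝ).pow s))
      refine ⟨Polynomial.C L + Polynomial.X * p, ?_⟩
      have h4 := (isBigO_refl u (l : Filter ι)).mul hp
      refine (EventuallyEq.trans_isBigO ?_ h4).congr_right fun j => (pow_succ' _ _).symm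
      filter_upwards [hu0] with j hj
      simp only [Polynomial.eval_add, Polynomial.eval_C, Polynomial.eval_mul, Polynomial.eval_X]
      field_simp
      ring

/-- A bounded family of functions in an algebra of bounded algebraic degree over `ℝ[t]` is
approximated by a polynomial arc. -/
theorem exists_polynomial_arc {κ : Type*} (ht : Tendsto t l (𝓝 0)) (ht0 : ∀ᶠ j in l, t j ≠ 0)
    (htA : t ∈ A)
    (hA : ∀ y ∈ A, ∃ c : Fin (M + 1) → Polynomial ℝ, (∃ i, c i ≠ 0) ∧
      ∀ᶠ j in l, ∑ i, (c i).eval (t j) * y j ^ (i : ℕ) = 0)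
    (x : κ → ι → ℝ) (hx : ∀ v, x v ∈ A) (hxb : ∀ v, x v =O[l] fun _ => (1 : ℝ)) :
    ∃ (e : ℕ) (u : ι → ℝ) (p : κ → Polynomial ℝ), 1 ≤ e ∧ e ≤ M ∧ Tendsto u l (𝓝 0) ∧
      (∀ᶠ j in l, u j ≠ 0) ∧ ((fun j => u j ^ e) =Θ[l] t) ∧
      ∀ v, (fun j => x v j - (p v).eval (u j)) =O[l] fun j => u j ^ (e + 1) := by
  have hA' : ∀ y ∈ A, (∀ᶠ j in l, y j ≠ 0) → ∃ (r : ℕ) (p : ℤ), 1 ≤ r ∧ r ≤ M ∧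
      (fun j => y j ^ r) =Θ[l] fun j => t j ^ p := by
    intro y hy hy0
    obtain ⟨c, hc, hrel⟩ := hA y hy
    exact newton_exponent l ht ht0 c hc hrel hy0
  obtain ⟨e, u, he, hu, hu0, hut, hval⟩ := exists_uniformizer ht0 htA hA'
  have hulim : Tendsto u l (𝓝 0) := by
    have h1 : Tendsto (fun j => u j ^ e) l (𝓝 0) := hut.tendsto_zero_iff.2 ht
    have h2 := h1.norm
    simp only [norm_pow, norm_zero] at h2
    rw [tendsto_zero_iff_norm_tendsto_zero]
    have h3 := h2.rpow_const (p := ((e : ℝ)⁻¹)) (Or.inr (by positivity))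
    rw [Real.zero_rpow (by positivity)] at h3
    refine h3.congr fun j => ?_
    rw [Real.pow_rpow_inv_natCast (norm_nonneg _) (by omega)]
  choose p hp using fun v =>
    exists_polynomial_expansion hu hu0 hulim hval (e + 1) (x v) (.of_mem (hx v)) (hxb v)
  exact ⟨e, u, p, he, ramification_le hA' he hu hu0 hut hulim hval, hulim, hu0, hut, hp⟩

end ArcExpansion

section ArcGradient
open Filter Topology Asymptotics

/-- Along a sequence approximated to order `e + 1` by a polynomial arc, on which `f` has order
`e`, the differential of `f` satisfies the Łojasiewicz gradient estimate with exponent `e`. -/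
theorem fderiv_isBigO_of_arc {ι : Type*} {l : Filter ι} [l.NeBot] {n : ℕ}
    {f : EuclideanSpace ℝ (Fin n) → ℝ} {z : EuclideanSpace ℝ (Fin n)} (hf : AnalyticAt ℝ f z)
    {x : ι → EuclideanSpace ℝ (Fin n)} (hx : Tendsto x l (𝓝 z)) {t u : ι → ℝ}
    (hfx : ∀ᶠ j in l, f (x j) = t j) {e : ℕ} (he : 1 ≤ e) (hu : Tendsto u l (𝓝 0))
    (hu0 : ∀ᶠ j in l, u j ≠ 0) (hut : (fun j => u j ^ e) =Θ[l] t)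
    (p : Fin n → Polynomial ℝ)
    (hp : ∀ v, (fun j => x j v - (p v).eval (u j)) =O[l] fun j => u j ^ (e + 1)) :
    (fun j => t j ^ (e - 1)) =O[l] fun j => ‖fderiv ℝ f (x j)‖ ^ e := by
  obtain ⟨γ, hγ⟩ : ∃ γ : ℝ → EuclideanSpace ℝ (Fin n),
      γ = fun s => WithLp.toLp 2 fun v => (p v).eval s := ⟨_, rfl⟩
  have hγv : ∀ s v, γ s v = (p v).eval s := by simp [hγ]
  have hγd : ∀ s, AnalyticAt ℝ γ s := by
    intro s
    have h1 : AnalyticAt ℝ (fun s v => (p v).eval s) s := by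
      rw [analyticAt_pi_iff]
      intro v
      simpa using AnalyticAt.aeval_polynomial (analyticAt_id (𝕜 := ℝ) (z := s)) (p v)
    rw [hγ]
    exact ((PiLp.continuousLinearEquiv 2 ℝ (fun _ : Fin n => ℝ)).symm.toContinuousLinearMap.analyticAt _).comp h1
  have hdiff : (fun j => x j - γ (u j)) =O[l] fun j => u j ^ (e + 1) := by
    have h1 : (fun j v => x j v - (p v).eval (u j)) =O[l] fun j => u j ^ (e + 1) :=
      isBigO_pi.2 hp
    refine IsBigO.trans ?_ h1
    have h2 := ((PiLp.continuousLinearEquiv 2 ℝ (fun _ : Fin n => ℝ)).symm.toContinuousLinearMap).isBigO_comp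
      (fun j v => x j v - (p v).eval (u j)) l
    refine h2.congr_left fun j => ?_
    ext v
    simp [hγv]
  have hpow0 : ∀ m : ℕ, Tendsto (fun j => u j ^ (m + 1)) l (𝓝 0) := fun m => by
    simpa using hu.pow (m + 1)
  have hγu : Tendsto (fun j => γ (u j)) l (𝓝 (γ 0)) := (hγd 0).continuousAt.tendsto.comp hu
  have hγ0 : γ 0 = z := by
    have h1 := hdiff.trans_tendsto (hpow0 e)
    have h2 := hx.sub h1
    simp only [sub_sub_cancel, sub_zero] at h2
    exact tendsto_nhds_unique hγu h2
  rw [hγ0] at hγu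
  have hpair : Tendsto (fun j => (x j, γ (u j))) l (𝓝 (z, z)) := hx.prodMk_nhds hγu
  have hfdiff : (fun j => f (x j) - f (γ (u j))) =O[l] fun j => u j ^ (e + 1) :=
    ((hf.hasStrictFDerivAt.isBigO_sub).comp_tendsto hpair).trans hdiff
  have hDdiff : (fun j => fderiv ℝ f (x j) - fderiv ℝ f (γ (u j))) =O[l] fun j => u j ^ (e + 1) :=
    ((hf.fderiv.hasStrictFDerivAt.isBigO_sub).comp_tendsto hpair).trans hdiff
  have hlit : ∀ a b : ℕ, a < b → (fun j => u j ^ b) =o[l] fun j => u j ^ a := fun a b hab =>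
    (isLittleO_pow_pow hab).comp_tendsto hu
  have hFu : (fun j => f (γ (u j))) =Θ[l] fun j => u j ^ e := by
    have h1 : (fun j => f (x j)) =Θ[l] fun j => u j ^ e :=
      EventuallyEq.trans_isTheta hfx hut.symm
    have h2 := ((hfdiff.trans_isLittleO (hlit e (e + 1) (by omega))).trans_isTheta
      h1.symm).neg_left.right_isTheta_add
    refine IsTheta.trans (EventuallyEq.isTheta ?_) (h2.symm.trans h1)
    filter_upwards with j
    simp
  have hF : AnalyticAt ℝ (fun s => f (γ s)) 0 := by
    refine AnalyticAt.fun_comp ?_ (hγd 0)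
    rwa [hγ0]
  obtain ⟨m, g, hg, hg0, hFg⟩ := hF.exists_eventuallyEq_pow_smul_nonzero_iff.2 (by
    intro h
    obtain ⟨j, h1, h2, h3⟩ := ((hu.eventually h).and (hu0.and hFu.eq_zero_iff)).exists
    exact pow_ne_zero _ h2 (h3.1 h1))
  simp only [sub_zero, smul_eq_mul] at hFg
  have hgu : (fun j => g (u j)) =Θ[l] fun _ => (1 : ℝ) :=
    isTheta_one_of_tendsto (hg.continuousAt.tendsto.comp hu) hg0
  have hme : m = e := by
    have h1 : (fun j => u j ^ m) =Θ[l] fun j => u j ^ e := by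
      refine IsTheta.trans ?_ hFu
      have h2 := ((isTheta_refl (fun j => u j ^ m) l).mul hgu).symm
      simp only [mul_one] at h2
      exact h2.trans_eventuallyEq ((hu.eventually hFg).mono fun j hj => hj.symm)
    have h2 := zpow_isTheta_injective (a := m) (b := e) hu hu0 (by simpa using h1)
    exact_mod_cast h2
  subst hme
  have hderiv : ∀ᶠ s in 𝓝 0, fderiv ℝ f (γ s) (deriv γ s)
      = s ^ (m - 1) * (m * g s + s * deriv g s) := by
    have hfγ : ∀ᶠ s in 𝓝 (0 : ℝ), DifferentiableAt ℝ f (γ s) := by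
      refine (hγd 0).continuousAt.eventually ?_
      rw [hγ0]
      exact hf.eventually_analyticAt.mono fun y hy => hy.differentiableAt
    filter_upwards [eventually_eventually_nhds.2 hFg, hg.eventually_analyticAt, hfγ] with s hs hgs hfs
    have h1 : HasDerivAt (fun s => f (γ s)) (fderiv ℝ f (γ s) (deriv γ s)) s :=
      hfs.hasFDerivAt.comp_hasDerivAt s (hγd s).differentiableAt.hasDerivAt
    have h2 : HasDerivAt (fun s => s ^ m * g s) (m * s ^ (m - 1) * g s + s ^ m * deriv g s) s :=
      (hasDerivAt_pow m s).mul hgs.differentiableAt.hasDerivAt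
    rw [(h1.congr_of_eventuallyEq (EventuallyEq.symm hs)).unique h2]
    obtain ⟨k, rfl⟩ := Nat.exists_eq_add_of_le' he
    simp only [Nat.add_sub_cancel]
    ring
  have hDγ : (fun j => u j ^ (m - 1)) =O[l] fun j => fderiv ℝ f (γ (u j)) := by
    have h1 : (fun j => m * g (u j) + u j * deriv g (u j)) =Θ[l] fun _ => (1 : ℝ) := by
      refine isTheta_one_of_tendsto (L := m * g 0 + 0 * deriv g 0) ?_ ?_
      · exact ((hg.continuousAt.tendsto.comp hu).const_mul _).add
          (hu.mul (hg.deriv.continuousAt.tendsto.comp hu))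
      · rw [zero_mul, add_zero]
        exact mul_ne_zero (by positivity) hg0
    have h2 := ((isTheta_refl (fun j => u j ^ (m - 1)) l).mul h1).symm
    simp only [mul_one] at h2
    have h3 : (fun j => fderiv ℝ f (γ (u j)) (deriv γ (u j))) =O[l]
        fun j => fderiv ℝ f (γ (u j)) := by
      have h4 : (fun j => deriv γ (u j)) =O[l] fun _ => (1 : ℝ) :=
        ((hγd 0).deriv.continuousAt.tendsto.comp hu).isBigO_one ℝ
      have h5 : (fun j => fderiv ℝ f (γ (u j)) (deriv γ (u j))) =O[l]
          fun j => ‖fderiv ℝ f (γ (u j))‖ * ‖deriv γ (u j)‖ :=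
        IsBigO.of_bound 1 (Eventually.of_forall fun j => by
          rw [one_mul, norm_mul, norm_norm, norm_norm]
          exact ContinuousLinearMap.le_opNorm _ _)
      refine h5.trans ?_
      simpa using (isBigO_refl (fun j => ‖fderiv ℝ f (γ (u j))‖) l).mul h4.norm_left
    exact h2.1.trans ((EventuallyEq.isBigO ((hu.eventually hderiv).mono fun j hj => hj.symm)).trans h3)
  have hDx : (fun j => u j ^ (m - 1)) =O[l] fun j => fderiv ℝ f (x j) := by
    have h1 := ((hDdiff.trans_isLittleO (hlit (m - 1) (m + 1) (by omega))).trans_isBigO hDγ)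
    have h2 := h1.neg_left.right_isBigO_sub
    refine hDγ.trans (h2.congr_right fun j => ?_)
    simp
  have h1 := (hut.symm.1.pow (m - 1)).trans (IsBigO.of_bound 1 (Eventually.of_forall fun j => ?_) :
    (fun j => (u j ^ m) ^ (m - 1)) =O[l] fun j => (u j ^ (m - 1)) ^ m)
  · exact h1.trans (hDx.norm_right.pow m)
  · rw [one_mul, ← pow_mul, ← pow_mul, mul_comm]

end ArcGradient

section SeparableRelation
open Filter Topology MvPolynomial

/-- Polynomials in `n + 1` variables as univariate polynomials in the last variable. -/
noncomputable def lastVarEquiv (n : ℕ) :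
    MvPolynomial (Fin (n + 1)) ℝ ≃ₐ[ℝ] Polynomial (MvPolynomial (Fin n) ℝ) :=
  (renameEquiv ℝ finSuccEquivLast).trans (optionEquivLeft ℝ (Fin n))

theorem evalAt_eq_eval_lastVarEquiv {n : ℕ} (p : MvPolynomial (Fin (n + 1)) ℝ) (x : Fin n → ℝ)
    (t : ℝ) : evalAt p x t = ((lastVarEquiv n p).map (eval x)).eval t := by
  unfold evalAt lastVarEquiv
  induction p using MvPolynomial.induction_on with
  | C a => simp [optionEquivLeft_C]
  | add p q hp hq => simp_all
  | mul_X p v hp =>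
    simp only [map_mul, Polynomial.map_mul, Polynomial.eval_mul, hp]
    congr 1
    refine Fin.lastCases ?_ (fun i => ?_) v
    · simp [optionEquivLeft_X_none]
    · simp [optionEquivLeft_X_some]

theorem evalAt_pderiv_last_eq {n : ℕ} (p : MvPolynomial (Fin (n + 1)) ℝ) (x : Fin n → ℝ)
    (t : ℝ) : evalAt (pderiv (Fin.last n) p) x t =
      ((lastVarEquiv n p).derivative.map (eval x)).eval t := by
  have h1 := hasDerivAt_evalAt p x t
  have h2 := ((lastVarEquiv n p).map (eval x)).hasDerivAt t
  simp only [evalAt_eq_eval_lastVarEquiv p] at h1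
  rw [h1.unique h2, Polynomial.derivative_map]

theorem eq_zero_of_eval_eq_zero_on_isOpen {n : ℕ} (q : MvPolynomial (Fin n) ℝ)
    {V : Set (Fin n → ℝ)} (hV : IsOpen V) (hne : V.Nonempty) (h : ∀ x ∈ V, eval x q = 0) :
    q = 0 := by
  obtain ⟨x, hx⟩ := hne
  obtain ⟨ε, hε, hball⟩ := Metric.isOpen_iff.1 hV x hx
  refine funext_set (fun i => Metric.ball (x i) ε) (fun i => ?_) fun y hy => ?_
  · rw [Real.ball_eq_Ioo]
    exact Set.Ioo_infinite (by linarith)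
  · rw [map_zero]
    refine h y (hball ?_)
    rw [ball_pi _ hε]
    exact hy

theorem exists_bezout_derivative {R : Type*} [CommRing R] [IsDomain R] [IsGCDMonoid R]
    [CharZero R] {p : Polynomial R} (hp : Irreducible p) (hdeg : p.natDegree ≠ 0) :
    ∃ (a b : Polynomial R) (r : R), r ≠ 0 ∧ a * p + b * p.derivative = Polynomial.C r := by
  obtain ⟨a, b, hab⟩ := (((hp.isPrimitive hdeg).irreducible_iff_irreducible_map_fraction_map
    (K := FractionRing R)).1 hp).separable
  obtain ⟨s, hs, ha⟩ := IsLocalization.integerNormalization_spec (nonZeroDivisors R) a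
  obtain ⟨s', hs', hb⟩ := IsLocalization.integerNormalization_spec (nonZeroDivisors R) b
  refine ⟨Polynomial.C s' * IsLocalization.integerNormalization (nonZeroDivisors R) a,
    Polynomial.C s * IsLocalization.integerNormalization (nonZeroDivisors R) b, s * s',
    mul_ne_zero (nonZeroDivisors.ne_zero hs) (nonZeroDivisors.ne_zero hs'), ?_⟩
  refine Polynomial.map_injective _ (IsFractionRing.injective R (FractionRing R)) ?_
  simp only [Polynomial.map_add, Polynomial.map_mul, ha, hb, Polynomial.map_C, map_mul,
    ← Polynomial.derivative_map]
  rw [Algebra.smul_def, Algebra.smul_def, Polynomial.algebraMap_apply, Polynomial.algebraMap_apply]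
  linear_combination (Polynomial.C (algebraMap R (FractionRing R) s) *
    Polynomial.C (algebraMap R (FractionRing R) s')) * hab

/-- A function annihilated by an irreducible polynomial is a simple root of it at some point of
every nonempty open set. -/
theorem exists_evalAt_pderiv_ne_zero {n : ℕ} {P : MvPolynomial (Fin (n + 1)) ℝ}
    (hP : Irreducible P) {V : Set (Fin n → ℝ)} (hV : IsOpen V) (hne : V.Nonempty)
    {F : (Fin n → ℝ) → ℝ} (hF : ∀ x ∈ V, evalAt P x (F x) = 0) :
    ∃ x ∈ V, evalAt (pderiv (Fin.last n) P) x (F x) ≠ 0 := by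
  by_contra! hcon
  have hp : Irreducible (lastVarEquiv n P) := (MulEquiv.irreducible_iff (lastVarEquiv n)).2 hP
  by_cases hdeg : (lastVarEquiv n P).natDegree = 0
  · obtain ⟨q, hq⟩ := Polynomial.natDegree_eq_zero.1 hdeg
    have hq0 : q = 0 := eq_zero_of_eval_eq_zero_on_isOpen q hV hne fun x hx => by
      simpa [evalAt_eq_eval_lastVarEquiv, ← hq] using hF x hx
    rw [← hq, hq0, map_zero] at hp
    exact not_irreducible_zero hp
  · obtain ⟨a, b, r, hr, hab⟩ := exists_bezout_derivative hp hdeg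
    refine hr (eq_zero_of_eval_eq_zero_on_isOpen r hV hne fun x hx => ?_)
    have h1 := congrArg (fun w => (w.map (eval x)).eval (F x)) hab
    simp only [Polynomial.map_add, Polynomial.map_mul, Polynomial.eval_add, Polynomial.eval_mul,
      Polynomial.map_C, Polynomial.eval_C] at h1
    rw [← evalAt_eq_eval_lastVarEquiv, ← evalAt_pderiv_last_eq, hF x hx, hcon x hx] at h1
    simpa using h1.symm

end SeparableRelation

section Lojasiewicz
open Filter Topology MvPolynomial Asymptotics

theorem norm_sq_eq_sum_apply_single {n : ℕ} (L : EuclideanSpace ℝ (Fin n) →L[ℝ] ℝ) :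
    ‖L‖ ^ 2 = ∑ i, L (EuclideanSpace.single i 1) ^ 2 := by
  obtain ⟨v, rfl⟩ := (InnerProductSpace.toDual ℝ (EuclideanSpace ℝ (Fin n))).surjective L
  rw [LinearIsometryEquiv.norm_map, EuclideanSpace.norm_sq_eq]
  refine Finset.sum_congr rfl fun i _ => ?_
  rw [InnerProductSpace.toDual_apply_apply, EuclideanSpace.inner_single_right]
  simp

theorem sum_sq_le_iff_mem_closedBall {n : ℕ} {x : Fin n → ℝ} {r : ℝ} (hr : 0 ≤ r) :
    ∑ i, x i ^ 2 ≤ r ^ 2 ↔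
      WithLp.toLp 2 x ∈ Metric.closedBall (0 : EuclideanSpace ℝ (Fin n)) r := by
  rw [mem_closedBall_zero_iff, ← sq_le_sq₀ (norm_nonneg _) hr, EuclideanSpace.norm_sq_eq]
  simp

/-- Implicit differentiation of `P (x, f x) = 0`. -/
theorem evalAt_pderiv_castSucc_add {n : ℕ} {U : Set (EuclideanSpace ℝ (Fin n))} (hU : IsOpen U)
    {f : EuclideanSpace ℝ (Fin n) → ℝ} {P : MvPolynomial (Fin (n + 1)) ℝ}
    (hPf : ∀ x ∈ U, evalAt P x.ofLp (f x) = 0) {x : EuclideanSpace ℝ (Fin n)} (hx : x ∈ U)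
    (hf : DifferentiableAt ℝ f x) (i : Fin n) :
    evalAt (pderiv i.castSucc P) x.ofLp (f x) + fderiv ℝ f x (EuclideanSpace.single i 1) *
      evalAt (pderiv (Fin.last n) P) x.ofLp (f x) = 0 := by
  obtain ⟨γ, hγ⟩ : ∃ γ : ℝ → EuclideanSpace ℝ (Fin n),
      γ = fun s => x + s • EuclideanSpace.single i 1 := ⟨_, rfl⟩
  have hγ0 : γ 0 = x := by simp [hγ]
  have hγd : HasDerivAt γ (EuclideanSpace.single i 1) 0 := by
    rw [hγ]
    simpa using ((hasDerivAt_id' (0 : ℝ)).smul_const (EuclideanSpace.single i (1 : ℝ))).const_add x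
  have hfγ : HasDerivAt (fun s => f (γ s)) (fderiv ℝ f x (EuclideanSpace.single i 1)) 0 := by
    have h1 : HasFDerivAt f (fderiv ℝ f x) (γ 0) := by rw [hγ0]; exact hf.hasFDerivAt
    exact h1.comp_hasDerivAt 0 hγd
  have h := hasDerivAt_eval_curve P
    (g := fun s => Fin.snoc (α := fun _ => ℝ) (γ s).ofLp (f (γ s)))
    (g' := Fin.snoc (α := fun _ => ℝ) (EuclideanSpace.single i (1 : ℝ)).ofLp
      (fderiv ℝ f x (EuclideanSpace.single i 1))) (s := 0) (fun v => by
      refine Fin.lastCases ?_ (fun j => ?_) v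
      · simpa using hfγ
      · simp only [Fin.snoc_castSucc]
        exact (EuclideanSpace.proj (𝕜 := ℝ) j).hasFDerivAt.comp_hasDerivAt 0 hγd)
  have h0 : HasDerivAt (fun _ : ℝ => (0 : ℝ)) 0 0 := hasDerivAt_const _ _
  have hev : (fun s => eval (Fin.snoc (α := fun _ => ℝ) (γ s).ofLp (f (γ s))) P)
      =ᶠ[𝓝 0] fun _ => (0 : ℝ) := by
    have hnhds : U ∈ 𝓝 (γ 0) := by rw [hγ0]; exact hU.mem_nhds hx
    filter_upwards [hγd.continuousAt hnhds] with s hs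
    have := hPf _ hs
    unfold evalAt at this
    exact this
  have h1 := h.unique (h0.congr_of_eventuallyEq hev)
  rw [Fin.sum_univ_castSucc] at h1
  simp only [Fin.snoc_castSucc, Fin.snoc_last, hγ0] at h1
  rw [Finset.sum_eq_single i] at h1
  · unfold evalAt
    simpa using h1
  · intro j _ hj
    simp [hj]
  · simp

theorem gradient_estimate_along_sequence {ι : Type*} {n : ℕ} {U : Set (EuclideanSpace ℝ (Fin n))}
    {f : EuclideanSpace ℝ (Fin n) → ℝ} (hU : IsOpen U) (hf : AnalyticOnNhd ℝ f U)
    {P : MvPolynomial (Fin (n + 1)) ℝ} (hP : 1 ≤ P.totalDegree)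
    (hPf : ∀ x ∈ U, evalAt P x.ofLp (f x) = 0) {δ : ℝ} (hδ : 0 < δ)
    (hδU : Metric.closedBall 0 δ ⊆ U) (l : Ultrafilter ι)
    {x : ι → EuclideanSpace ℝ (Fin n)} (hx : ∀ j, x j ∈ Metric.closedBall 0 (δ / 2))
    (hfx : Tendsto (fun j => f (x j)) l (𝓝 0)) (hfx0 : ∀ j, f (x j) ≠ 0)
    (hsep : ∀ j, evalAt (pderiv (Fin.last n) P) (x j).ofLp (f (x j)) ≠ 0) :
    ∃ e : ℕ, 1 ≤ e ∧ e ≤ (2 * P.totalDegree + 4) ^ (n + 1) ∧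
      (fun j => f (x j) ^ (e - 1)) =O[l] fun j => ‖fderiv ℝ f (x j)‖ ^ e := by
  obtain ⟨c, hc, hcomp⟩ := exists_comparison_relations P hP hδ
  have hmaps : Set.MapsTo (fun y : Fin n → ℝ => WithLp.toLp 2 y) {y | ∑ i, y i ^ 2 ≤ δ ^ 2} U :=
    fun y hy => hδU ((sum_sq_le_iff_mem_closedBall hδ.le).1 hy)
  have htoLp : Continuous fun y : Fin n → ℝ => WithLp.toLp 2 y := PiLp.continuous_toLp 2 _
  have key := fun j => hcomp (fun y => f (WithLp.toLp 2 y))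
    (fun i y => fderiv ℝ f (WithLp.toLp 2 y) (EuclideanSpace.single i 1))
    (hf.continuousOn.comp htoLp.continuousOn hmaps)
    (fun i => (hf.fderiv.continuousOn.clm_apply continuousOn_const).comp htoLp.continuousOn hmaps)
    (fun y hy => hPf _ (hmaps hy))
    (fun y hy i => evalAt_pderiv_castSucc_add hU hPf (hmaps hy)
      (hf _ (hmaps hy)).differentiableAt i)
    (x j).ofLp (by
      have := (sum_sq_le_iff_mem_closedBall (x := (x j).ofLp) (half_pos hδ).le).2 (hx j)
      linarith [this, div_pow δ 2 2])
    (hsep j)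
  choose y hyδ hyf hyD hyrel using key
  simp only [WithLp.toLp_ofLp] at hyf hyD hyrel
  have hyball : ∀ j, WithLp.toLp 2 (y j) ∈ Metric.closedBall (0 : EuclideanSpace ℝ (Fin n)) δ :=
    fun j => (sum_sq_le_iff_mem_closedBall hδ.le).1 (hyδ j)
  obtain ⟨z, hz, hlim⟩ : ∃ z ∈ Metric.closedBall (0 : EuclideanSpace ℝ (Fin n)) δ,
      Tendsto (fun j => WithLp.toLp 2 (y j)) l (𝓝 z) := by
    have hmem : ↑(l.map fun j => WithLp.toLp 2 (y j)) ≤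
        𝓟 (Metric.closedBall (0 : EuclideanSpace ℝ (Fin n)) δ) := by
      rw [le_principal_iff, Ultrafilter.mem_coe, Ultrafilter.mem_map]
      exact Eventually.of_forall hyball
    obtain ⟨z, hz, h⟩ := (isCompact_closedBall _ δ).ultrafilter_le_nhds _ hmem
    exact ⟨z, hz, h⟩
  let Φ : MvPolynomial (Fin (n + 1)) ℝ →ₐ[ℝ] (ι → ℝ) :=
    AlgHom.pi fun j => aeval (Fin.snoc (α := fun _ => ℝ) (y j) (f (x j)))
  have hΦ : ∀ Y j, Φ Y j = evalAt Y (y j) (f (x j)) := by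
    intro Y j
    unfold evalAt
    simp [Φ, aeval_eq_eval]
  have hΦlast : Φ (X (Fin.last n)) = fun j => f (x j) := by
    funext j
    simp [Φ]
  have hΦv : ∀ v : Fin n, Φ (X v.castSucc) = fun j => y j v := by
    intro v
    funext j
    simp [Φ]
  obtain ⟨e, u, p, he, heM, hu, hu0, hut, hp⟩ := exists_polynomial_arc (l := l)
    (A := Φ.range) (t := fun j => f (x j)) (M := (2 * P.totalDegree + 4) ^ (n + 1)) hfx
    (Eventually.of_forall hfx0) ⟨_, hΦlast⟩ (by
      rintro _ ⟨Y, rfl⟩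
      refine ⟨c Y, hc Y, Eventually.of_forall fun j => ?_⟩
      have := hyrel j Y
      change ∑ i, (c Y i).eval (f (x j)) * Φ Y j ^ (i : ℕ) = 0
      simp only [hΦ]
      exact this) (fun v j => y j v) (fun v => ⟨_, hΦv v⟩) (fun v => by
      refine IsBigO.of_bound δ (Eventually.of_forall fun j => ?_)
      have h1 := EuclideanSpace.norm_sq_eq (WithLp.toLp 2 (y j))
      have h2 := (PiLp.norm_apply_le (WithLp.toLp 2 (y j)) v).trans
        (mem_closedBall_zero_iff.1 (hyball j))
      simpa using h2)
  refine ⟨e, he, heM, ?_⟩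
  have h1 := fderiv_isBigO_of_arc (hf z (hδU hz)) hlim (t := fun j => f (x j))
    (Eventually.of_forall hyf) he hu hu0 hut p hp
  refine h1.trans (IsBigO.pow (IsBigO.of_bound (4 / 3) (Eventually.of_forall fun j => ?_)) e)
  rw [norm_norm, norm_norm]
  refine abs_le_of_sq_le_sq' ?_ (by positivity) |>.2
  rw [mul_pow, norm_sq_eq_sum_apply_single, norm_sq_eq_sum_apply_single]
  norm_num
  exact hyD j

end Lojasiewicz

section LojasiewiczInequality
open Filter Topology MvPolynomial Asymptotics

theorem degree_bound_le {n d : ℕ} (hn : 1 ≤ n) (hd : 2 ≤ d) :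
    (2 * d + 4) ^ (n + 1) ≤ 2 * (2 * d - 1) ^ (3 * n + 1) := by
  have h1 : 2 * d + 4 ≤ (2 * d - 1) ^ 2 := by
    obtain ⟨m, rfl⟩ := Nat.exists_eq_add_of_le hd
    have : 2 * (2 + m) - 1 = 2 * m + 3 := by omega
    rw [this]
    nlinarith
  calc (2 * d + 4) ^ (n + 1) ≤ ((2 * d - 1) ^ 2) ^ (n + 1) := by gcongr
    _ = (2 * d - 1) ^ (2 * (n + 1)) := by rw [pow_mul]
    _ ≤ (2 * d - 1) ^ (3 * n + 1) := Nat.pow_le_pow_right (by omega) (by omega)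
    _ ≤ 2 * (2 * d - 1) ^ (3 * n + 1) := by omega

theorem eventually_eq_zero_of_totalDegree_le_one {n : ℕ} {U : Set (EuclideanSpace ℝ (Fin n))}
    {f : EuclideanSpace ℝ (Fin n) → ℝ} (hU : IsOpen U) (h0U : (0 : EuclideanSpace ℝ (Fin n)) ∈ U)
    (hf : AnalyticOnNhd ℝ f U) (hf0 : f 0 = 0) {P : MvPolynomial (Fin (n + 1)) ℝ}
    (hP : P.totalDegree ≤ 1) (hPf : ∀ x ∈ U, evalAt P x.ofLp (f x) = 0)
    (hsep : ∃ x ∈ U, evalAt (pderiv (Fin.last n) P) x.ofLp (f x) ≠ 0)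
    (hD0 : fderiv ℝ f 0 = 0) : ∀ᶠ x in 𝓝 0, f x = 0 := by
  have hconst : ∀ v, ∃ a : ℝ, ∀ x t, evalAt (pderiv v P) x t = a := by
    intro v
    have h1 := totalDegree_pderiv_le_sub_one v P
    have h2 := totalDegree_eq_zero_iff_eq_C.1 (show (pderiv v P).totalDegree = 0 by omega)
    refine ⟨coeff 0 (pderiv v P), fun x t => ?_⟩
    rw [h2, coeff_C, if_pos rfl]
    unfold evalAt
    exact eval_C _
  choose a ha using hconst
  have hchain := fun x (hx : x ∈ U) i =>
    evalAt_pderiv_castSucc_add hU hPf hx (hf x hx).differentiableAt i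
  simp only [ha] at hchain hsep
  obtain ⟨-, -, hlast⟩ := hsep
  have ha0 : ∀ i : Fin n, a i.castSucc = 0 := fun i => by
    simpa [hD0] using hchain 0 h0U i
  have hD : ∀ x ∈ U, fderiv ℝ f x = 0 := by
    intro x hx
    have h1 := norm_sq_eq_sum_apply_single (fderiv ℝ f x)
    rw [Finset.sum_eq_zero] at h1
    · simpa using h1
    · intro i _
      have := hchain x hx i
      rw [ha0, zero_add, mul_eq_zero] at this
      simp [this.resolve_right hlast]
  obtain ⟨r, hr, hball⟩ := Metric.isOpen_iff.1 hU 0 h0U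
  filter_upwards [Metric.ball_mem_nhds 0 hr] with x hx
  rw [← hf0]
  refine (convex_ball (0 : EuclideanSpace ℝ (Fin n)) r).is_const_of_fderivWithin_eq_zero
    (𝕜 := ℝ) (f := f)
    (fun y hy => (hf y (hball hy)).differentiableAt.differentiableWithinAt) (fun y hy => ?_) hx
    (Metric.mem_ball_self hr)
  rw [fderivWithin_of_isOpen Metric.isOpen_ball hy, hD y (hball hy)]

theorem pow_lt_of_exponent_le {t G C N : ℝ} {e k : ℕ} (he : 1 ≤ e) (hek : e ≤ k) (ht : 0 ≤ t)
    (ht1 : t ≤ 1) (hG : 0 ≤ G) (hN : 0 ≤ N) (h1 : t ^ (e - 1) ≤ C * G ^ e)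
    (h2 : N * G ^ k < t ^ (k - 1)) : N ^ e < C ^ k := by
  have h3 : (N * G ^ k) ^ e < (t ^ (k - 1)) ^ e := by gcongr
  have h4 : (t ^ (k - 1)) ^ e ≤ (t ^ (e - 1)) ^ k := by
    rw [← pow_mul, ← pow_mul]
    refine pow_le_pow_of_le_one ht ht1 ?_
    rw [Nat.sub_mul, Nat.sub_mul, mul_comm e k]
    omega
  have h5 : (t ^ (e - 1)) ^ k ≤ (C * G ^ e) ^ k := by gcongr
  have h6 := h3.trans_le (h4.trans h5)
  rw [mul_pow, mul_pow, ← pow_mul, ← pow_mul, mul_comm e k] at h6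
  exact lt_of_mul_lt_mul_right h6 (by positivity)

/-- The gradient inequality with an exponent depending only on the degree of the annihilating
polynomial and the number of variables. -/
theorem exists_gradient_inequality {n : ℕ} {U : Set (EuclideanSpace ℝ (Fin n))}
    {f : EuclideanSpace ℝ (Fin n) → ℝ} (hU : IsOpen U) (h0U : (0 : EuclideanSpace ℝ (Fin n)) ∈ U)
    (hf : AnalyticOnNhd ℝ f U) (hf0 : f 0 = 0) {P : MvPolynomial (Fin (n + 1)) ℝ}
    (hP : Irreducible P) (hPdeg : 1 ≤ P.totalDegree) (hPf : ∀ x ∈ U, evalAt P x.ofLp (f x) = 0) :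
    ∃ C ≥ 0, ∀ᶠ x in 𝓝 0, |f x| ^ (2 * (2 * P.totalDegree - 1) ^ (3 * n + 1) - 1) ≤
      C * ‖fderiv ℝ f x‖ ^ (2 * (2 * P.totalDegree - 1) ^ (3 * n + 1)) := by
  have hk2 : 2 ≤ 2 * (2 * P.totalDegree - 1) ^ (3 * n + 1) := by
    have : 1 ≤ (2 * P.totalDegree - 1) ^ (3 * n + 1) := Nat.one_le_pow _ _ (by omega)
    omega
  have hM := fun h1 h2 => degree_bound_le (n := n) (d := P.totalDegree) h1 h2
  obtain ⟨k, hk⟩ : ∃ k, k = 2 * (2 * P.totalDegree - 1) ^ (3 * n + 1) := ⟨_, rfl⟩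
  rw [← hk] at hk2 hM ⊢
  have htriv : (∀ᶠ x in 𝓝 0, f x = 0) → ∃ C ≥ 0, ∀ᶠ x in 𝓝 0, |f x| ^ (k - 1) ≤
      C * ‖fderiv ℝ f x‖ ^ k := fun h => ⟨0, le_rfl, h.mono fun x hx => by
    rw [hx, abs_zero, zero_pow (by omega), zero_mul]⟩
  have hfc : Tendsto f (𝓝 0) (𝓝 0) := by simpa [hf0] using (hf 0 h0U).continuousAt.tendsto
  have hsmall : ∀ᶠ x in 𝓝 0, |f x| ≤ 1 :=
    (hfc.abs.eventually_lt_const (by simp : |(0 : ℝ)| < 1)).mono fun x hx => hx.le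
  have hseparable : ∀ V : Set (EuclideanSpace ℝ (Fin n)), IsOpen V → V.Nonempty → V ⊆ U →
      ∃ x ∈ V, evalAt (pderiv (Fin.last n) P) x.ofLp (f x) ≠ 0 := by
    intro V hV ⟨x, hx⟩ hVU
    obtain ⟨y, hy, h⟩ := exists_evalAt_pderiv_ne_zero hP
      (hV.preimage (PiLp.continuous_toLp 2 (fun _ : Fin n => ℝ))) ⟨x.ofLp, hx⟩
      (F := fun y => f (WithLp.toLp 2 y)) (fun y hy => hPf _ (hVU hy))
    exact ⟨_, hy, h⟩
  by_cases hD0 : fderiv ℝ f 0 = 0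
  swap
  · have hc : 0 < ‖fderiv ℝ f 0‖ / 2 := half_pos (norm_pos_iff.2 hD0)
    have h1 : ∀ᶠ x in 𝓝 0, ‖fderiv ℝ f 0‖ / 2 < ‖fderiv ℝ f x‖ :=
      (hf.fderiv 0 h0U).continuousAt.norm.tendsto.eventually_const_lt (half_lt_self (by linarith))
    refine ⟨((‖fderiv ℝ f 0‖ / 2) ^ k)⁻¹, by positivity, ?_⟩
    filter_upwards [h1, hsmall] with x hx hx1
    calc |f x| ^ (k - 1) ≤ 1 := pow_le_one₀ (abs_nonneg _) hx1
      _ = ((‖fderiv ℝ f 0‖ / 2) ^ k)⁻¹ * (‖fderiv ℝ f 0‖ / 2) ^ k := by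
        rw [inv_mul_cancel₀ (by positivity)]
      _ ≤ _ := by gcongr
  by_cases hd : P.totalDegree ≤ 1
  · exact htriv (eventually_eq_zero_of_totalDegree_le_one hU h0U hf hf0 hd hPf
      (hseparable U hU ⟨0, h0U⟩ subset_rfl) hD0)
  rcases Nat.eq_zero_or_pos n with rfl | hn
  · exact htriv (Eventually.of_forall fun x => by rw [Subsingleton.elim x 0, hf0])
  by_contra! hcon
  obtain ⟨δ, hδ, hδU⟩ := Metric.nhds_basis_closedBall.mem_iff.1 (hU.mem_nhds h0U)
  have hseq : ∀ N : ℕ, ∃ x : EuclideanSpace ℝ (Fin n), ‖x‖ < δ / 2 ∧ ‖x‖ < 1 / (N + 1) ∧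
      N * ‖fderiv ℝ f x‖ ^ k < |f x| ^ (k - 1) ∧
      evalAt (pderiv (Fin.last n) P) x.ofLp (f x) ≠ 0 := by
    intro N
    have hρ : 0 < min (δ / 2) (1 / ((N : ℝ) + 1)) := lt_min (by linarith) (by positivity)
    have hsub : Metric.ball (0 : EuclideanSpace ℝ (Fin n)) (min (δ / 2) (1 / ((N : ℝ) + 1))) ⊆ U :=
      (Metric.ball_subset_closedBall.trans (Metric.closedBall_subset_closedBall
        ((min_le_left _ _).trans (by linarith)))).trans hδU
    have h1 := hcon N (Nat.cast_nonneg N)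
    obtain ⟨x, hx, hxN⟩ := (h1.and_eventually (Metric.ball_mem_nhds 0 hρ)).exists
    have hopen : IsOpen (Metric.ball (0 : EuclideanSpace ℝ (Fin n))
        (min (δ / 2) (1 / ((N : ℝ) + 1))) ∩
        (fun x => |f x| ^ (k - 1) - N * ‖fderiv ℝ f x‖ ^ k) ⁻¹' Set.Ioi 0) := by
      refine ContinuousOn.isOpen_inter_preimage ?_ Metric.isOpen_ball isOpen_Ioi
      exact ((hf.continuousOn.abs.pow _).sub
        (continuousOn_const.mul (hf.fderiv.continuousOn.norm.pow _))).mono hsub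
    obtain ⟨y, ⟨hy1, hy2⟩, hy3⟩ := hseparable _ hopen ⟨x, hxN, by simpa using hx⟩
      (Set.inter_subset_left.trans hsub)
    rw [mem_ball_zero_iff, lt_min_iff] at hy1
    exact ⟨y, hy1.1, hy1.2, by simpa using hy2, hy3⟩
  choose x hxδ hxN hxk hxsep using hseq
  have hxlim : Tendsto x (hyperfilter ℕ) (𝓝 0) := by
    rw [tendsto_zero_iff_norm_tendsto_zero]
    refine squeeze_zero (fun _ => norm_nonneg _) (fun N => (hxN N).le) ?_
    exact tendsto_one_div_add_atTop_nhds_zero_nat.mono_left Nat.hyperfilter_le_atTop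
  obtain ⟨e, he, heM, hO⟩ := gradient_estimate_along_sequence hU hf hPdeg hPf hδ hδU
    (hyperfilter ℕ) (x := x) (fun N => by simpa using (hxδ N).le) (hfc.comp hxlim)
    (fun N h0 => by
      have := hxk N
      rw [h0, abs_zero, zero_pow (by omega)] at this
      exact absurd this (not_lt.2 (by positivity))) hxsep
  obtain ⟨C, -, hbound⟩ := hO.exists_nonneg
  have hlarge : ∀ᶠ N : ℕ in hyperfilter ℕ, C ^ k ≤ N := Nat.hyperfilter_le_atTop
    (tendsto_natCast_atTop_atTop.eventually_ge_atTop _)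
  have hpos : ∀ᶠ N : ℕ in hyperfilter ℕ, 1 ≤ N := Nat.hyperfilter_le_atTop
    (eventually_ge_atTop 1)
  obtain ⟨N, h1, h2, h3, h4⟩ :=
    (hbound.bound.and (hlarge.and (hpos.and (hxlim.eventually hsmall)))).exists
  rw [norm_pow, norm_pow, norm_norm, Real.norm_eq_abs] at h1
  have h5 := pow_lt_of_exponent_le he (heM.trans (hM hn (by omega))) (abs_nonneg _) h4
    (norm_nonneg _) (Nat.cast_nonneg N) h1 (hxk N)
  have h6 : (N : ℝ) ≤ (N : ℝ) ^ e := le_self_pow₀ (by exact_mod_cast h3) (by omega)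
  linarith

end LojasiewiczInequality

section DistanceInequality
open Filter Topology Metric

theorem opNorm_le_of_eventually_le_add {E : Type*} [NormedAddCommGroup E] [NormedSpace ℝ E]
    {g : E → ℝ} {L : E →L[ℝ] ℝ} {y : E} {c : ℝ} (hc : 0 ≤ c) (hg : HasFDerivAt g L y)
    (hmin : ∀ᶠ z in 𝓝 y, g y ≤ g z + c * ‖z - y‖) : ‖L‖ ≤ c := by
  refine le_of_forall_pos_le_add fun ε hε => ?_
  have h1 : ∀ᶠ v in 𝓝 (0 : E), -L v ≤ (c + ε) * ‖v‖ := by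
    have h2 : Tendsto (fun v => y + v) (𝓝 0) (𝓝 y) := by
      simpa using (continuous_const_add y).tendsto 0
    filter_upwards [h2.eventually hmin,
      (hasFDerivAt_iff_isLittleO_nhds_zero.1 hg).def hε] with v hv hv'
    rw [Real.norm_eq_abs] at hv'
    have := (abs_le.1 hv').2
    rw [add_sub_cancel_left] at hv
    linarith
  have h3 : ∀ᶠ v in 𝓝 (0 : E), -L (-v) ≤ (c + ε) * ‖-v‖ := by
    have : Tendsto (fun v : E => -v) (𝓝 0) (𝓝 0) := by simpa using (continuous_neg (G := E)).tendsto 0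
    exact this.eventually h1
  refine ContinuousLinearMap.opNorm_le_of_nhds_zero (by positivity) ?_
  filter_upwards [h1, h3] with v hv hv'
  rw [map_neg, neg_neg, norm_neg] at hv'
  rw [Real.norm_eq_abs, abs_le]
  constructor <;> linarith

theorem infDist_le_of_gradient_bound {E : Type*} [NormedAddCommGroup E] [NormedSpace ℝ E]
    [ProperSpace E] {Z : Set E} {g : E → ℝ} {r c : ℝ} (hc : 0 < c) (h0 : (0 : E) ∈ Z)
    (hgc : ContinuousOn g (ball 0 r)) (hg0 : ∀ x, 0 ≤ g x)
    (hgrad : ∀ x ∈ ball (0 : E) r, x ∉ Z → ∃ L : E →L[ℝ] ℝ, HasFDerivAt g L x ∧ c < ‖L‖)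
    {x : E} (hx : ‖x‖ < r / 2) : c * infDist x Z ≤ g x := by
  by_contra! hlt
  have hρ : infDist x Z ≤ ‖x‖ := by simpa using infDist_le_dist_of_mem (x := x) h0
  have hρ0 : 0 < infDist x Z := by
    have := (hg0 x).trans_lt hlt
    exact pos_of_mul_pos_right this hc.le
  have hsub : closedBall x (infDist x Z) ⊆ ball 0 r := by
    intro y hy
    rw [mem_closedBall, dist_eq_norm] at hy
    rw [mem_ball_zero_iff]
    have := norm_add_le (y - x) x
    rw [sub_add_cancel] at this
    linarith
  obtain ⟨y, hy, hmin⟩ := (isCompact_closedBall x (infDist x Z)).exists_isMinOn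
    ⟨x, mem_closedBall_self hρ0.le⟩ (f := fun y => g y + c * ‖y - x‖)
    ((hgc.mono hsub).add (by fun_prop))
  have h1 := hmin (mem_closedBall_self hρ0.le)
  simp only [Set.mem_ofPred_eq, sub_self, norm_zero, mul_zero, add_zero] at h1
  have h2 : ‖y - x‖ < infDist x Z := by
    have := hg0 y
    nlinarith
  have hyZ : y ∉ Z := fun hyZ => by
    have := infDist_le_dist_of_mem (x := x) hyZ
    rw [dist_comm, dist_eq_norm] at this
    linarith
  obtain ⟨L, hL, hLc⟩ := hgrad y (hsub hy) hyZ
  refine absurd (opNorm_le_of_eventually_le_add hc.le hL ?_) (not_le.2 hLc)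
  filter_upwards [isOpen_ball.mem_nhds (show y ∈ ball x (infDist x Z) by
    rwa [mem_ball, dist_eq_norm])] with z hz
  have h3 := hmin (ball_subset_closedBall hz)
  simp only [Set.mem_ofPred_eq] at h3
  have h4 := norm_add_le (z - y) (y - x)
  rw [sub_add_sub_cancel] at h4
  nlinarith

theorem rpow_inv_sub_one_pow_mul {a : ℝ} (ha : 0 < a) {k : ℕ} (hk : 1 ≤ k) :
    (a ^ ((k : ℝ)⁻¹ - 1)) ^ k * a ^ (k - 1) = 1 := by
  rw [← Real.rpow_natCast, ← Real.rpow_mul ha.le, ← Real.rpow_natCast, ← Real.rpow_add ha,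
    Nat.cast_sub hk, sub_mul, inv_mul_cancel₀ (by positivity)]
  simp

/-- A gradient inequality bounds the distance to the zero set. -/
theorem exists_gradient_distance_inequality {E : Type*} [NormedAddCommGroup E] [NormedSpace ℝ E]
    [ProperSpace E] {U : Set E} (hU : IsOpen U) (h0U : (0 : E) ∈ U) {f : E → ℝ}
    (hf : ∀ x ∈ U, DifferentiableAt ℝ f x) (hf0 : f 0 = 0) {k : ℕ} (hk : 1 ≤ k) {C : ℝ}
    (hL : ∀ᶠ x in 𝓝 0, |f x| ^ (k - 1) ≤ C * ‖fderiv ℝ f x‖ ^ k) :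
    ∃ c > 0, ∀ᶠ x in 𝓝 0, c * infDist x {x ∈ U | f x = 0} ^ (k - 1) ≤ ‖fderiv ℝ f x‖ := by
  wlog hC : 1 ≤ C generalizing C
  · refine this (C := max C 1) (hL.mono fun x hx => hx.trans ?_) (le_max_right _ _)
    gcongr
    exact le_max_left _ _
  obtain ⟨r, hr, hball⟩ := Metric.mem_nhds_iff.1 (inter_mem (hU.mem_nhds h0U) hL)
  obtain ⟨c, hc⟩ : ∃ c, c = (k : ℝ)⁻¹ / (2 * C) := ⟨_, rfl⟩
  have hk0 : (0 : ℝ) < (k : ℝ)⁻¹ := by positivity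
  have hc0 : 0 < c := by rw [hc]; positivity
  have hck : c ^ k * C < ((k : ℝ)⁻¹) ^ k := by
    have h1 : (k : ℝ)⁻¹ = c * (2 * C) := by rw [hc]; field_simp
    rw [h1, mul_pow]
    have h2 : 2 * C ≤ (2 * C) ^ k := le_self_pow₀ (by linarith) (by omega)
    have h3 : 0 < c ^ k := by positivity
    nlinarith
  have hdist : ∀ x : E, ‖x‖ < r / 2 →
      c * infDist x {x ∈ U | f x = 0} ≤ |f x| ^ ((k : ℝ)⁻¹) := by
    intro x hx
    refine infDist_le_of_gradient_bound (g := fun x => |f x| ^ ((k : ℝ)⁻¹)) (r := r) hc0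
      (show (0 : E) ∈ {x ∈ U | f x = 0} from ⟨h0U, hf0⟩) ?_
      (fun x => Real.rpow_nonneg (abs_nonneg _) _) ?_ hx
    · refine ContinuousOn.rpow_const (fun y hy => ?_) fun y _ => Or.inr hk0.le
      exact (hf y (hball hy).1).continuousAt.continuousWithinAt.abs
    · intro y hy hyZ
      have hfy : f y ≠ 0 := fun h => hyZ ⟨(hball hy).1, h⟩
      have habs : 0 < |f y| := abs_pos.2 hfy
      have h1 : HasDerivAt (fun u : ℝ => |u| ^ ((k : ℝ)⁻¹))
          ((SignType.sign (f y) : ℝ) * (k : ℝ)⁻¹ * |f y| ^ ((k : ℝ)⁻¹ - 1)) (f y) :=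
        (hasDerivAt_abs hfy).rpow_const (Or.inl habs.ne')
      refine ⟨_, h1.comp_hasFDerivAt y (hf y (hball hy).1).hasFDerivAt, ?_⟩
      have hsign : |(SignType.sign (f y) : ℝ)| = 1 := by
        rcases hfy.lt_or_gt with h | h <;> simp [h]
      rw [norm_smul, Real.norm_eq_abs, abs_mul, abs_mul, hsign, one_mul, abs_of_pos hk0,
        abs_of_pos (Real.rpow_pos_of_pos habs _)]
      refine lt_of_pow_lt_pow_left₀ k (by positivity) ?_
      have h2 := rpow_inv_sub_one_pow_mul habs hk
      have h3 : (0 : ℝ) < (|f y| ^ ((k : ℝ)⁻¹ - 1)) ^ k := by positivity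
      have h4 := mul_le_mul_of_nonneg_left (hball hy).2 h3.le
      rw [h2] at h4
      rw [mul_pow, mul_pow, mul_assoc]
      have h5 : 0 < c ^ k := by positivity
      obtain ⟨w, hw⟩ : ∃ w, w = (|f y| ^ ((k : ℝ)⁻¹ - 1)) ^ k * ‖fderiv ℝ f y‖ ^ k := ⟨_, rfl⟩
      rw [← hw]
      have h6 : 1 ≤ C * w := by rw [hw]; linarith
      have h7 : 0 < w := pos_of_mul_pos_right (by linarith : 0 < C * w) (by linarith)
      calc c ^ k ≤ c ^ k * (C * w) := le_mul_of_one_le_right h5.le h6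
        _ = c ^ k * C * w := by ring
        _ < _ := by gcongr
  refine ⟨c ^ (k - 1) / C, by positivity, ?_⟩
  filter_upwards [hL, ball_mem_nhds 0 (half_pos hr)] with x hx hxr
  have h1 := hdist x (by simpa using hxr)
  have h2 : (c * infDist x {x ∈ U | f x = 0}) ^ k ≤ |f x| := by
    calc _ ≤ (|f x| ^ ((k : ℝ)⁻¹)) ^ k := by gcongr; exact mul_nonneg hc0.le infDist_nonneg
      _ = |f x| := Real.rpow_inv_natCast_pow (abs_nonneg _) (by omega)
  have h3 : ((c * infDist x {x ∈ U | f x = 0}) ^ (k - 1)) ^ k ≤ (C * ‖fderiv ℝ f x‖) ^ k := by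
    calc _ = ((c * infDist x {x ∈ U | f x = 0}) ^ k) ^ (k - 1) := by
          rw [← pow_mul, ← pow_mul, mul_comm k]
      _ ≤ |f x| ^ (k - 1) := by
          gcongr
          exact pow_nonneg (mul_nonneg hc0.le infDist_nonneg) _
      _ ≤ C * ‖fderiv ℝ f x‖ ^ k := hx
      _ ≤ C ^ k * ‖fderiv ℝ f x‖ ^ k := by
          gcongr
          exact le_self_pow₀ hC (by omega)
      _ = _ := (mul_pow _ _ _).symm
  have h4 := le_of_pow_le_pow_left₀ (by omega) (by positivity) h3
  rw [mul_pow] at h4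
  rw [div_mul_eq_mul_div, div_le_iff₀ (by linarith)]
  linarith

end DistanceInequality

section FlatFunctions
open Filter Topology Metric

variable {E : Type*} [NormedAddCommGroup E] [NormedSpace ℝ E]

theorem norm_iteratedFDeriv_le_of_flat {g : E → ℝ} {k : ℕ} {s : Set E} (hs : Convex ℝ s)
    (hg : ∀ y ∈ s, ContDiffAt ℝ k g y) {a : E} (ha : a ∈ s)
    (hflat : ∀ i ≤ k, iteratedFDeriv ℝ i g a = 0) {ε : ℝ}
    (hε : ∀ y ∈ s, ‖iteratedFDeriv ℝ k g y‖ ≤ ε) (j : ℕ) (hj : j ≤ k) :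
    ∀ x ∈ s, ‖iteratedFDeriv ℝ (k - j) g x‖ ≤ ε * ‖x - a‖ ^ j := by
  have hε0 : 0 ≤ ε := (norm_nonneg _).trans (hε a ha)
  induction j with
  | zero => simpa using hε
  | succ j ih =>
    intro x hx
    have hseg := hs.segment_subset ha hx
    have h1 : k - j = k - (j + 1) + 1 := by omega
    have h2 : ∀ y ∈ segment ℝ a x, ‖fderiv ℝ (iteratedFDeriv ℝ (k - (j + 1)) g) y‖ ≤
        ε * ‖x - a‖ ^ j := by
      intro y hy
      rw [norm_fderiv_iteratedFDeriv, ← h1]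
      refine (ih (by omega) y (hseg hy)).trans ?_
      gcongr
      rw [← dist_eq_norm, ← dist_eq_norm]
      have := segment_subset_closedBall_left a x hy
      rw [mem_closedBall] at this
      rwa [dist_comm x a]
    have h3 := Convex.norm_image_sub_le_of_norm_fderiv_le (𝕜 := ℝ) (fun y hy =>
      (hg y (hseg hy)).differentiableAt_iteratedFDeriv (m := k - (j + 1))
        (by exact_mod_cast (by omega))) h2 (convex_segment a x) (left_mem_segment ℝ a x)
      (right_mem_segment ℝ a x)
    rwa [hflat _ (by omega), sub_zero, mul_assoc, ← pow_succ] at h3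

/-- A `C^k` function that is flat to order `k` along `Z` is `o(dist(·, Z)^k)`, and its
differential is `o(dist(·, Z)^(k-1))`. -/
theorem eventually_le_infDist_pow_of_flat {g : E → ℝ} {k : ℕ} (hk : 1 ≤ k) {Z : Set E}
    (h0 : (0 : E) ∈ Z) (hg : ∀ᶠ y in 𝓝 0, ContDiffAt ℝ k g y)
    (hflat : ∀ᶠ a in 𝓝 0, a ∈ Z → ∀ i ≤ k, iteratedFDeriv ℝ i g a = 0) {ε : ℝ} (hε : 0 < ε) :
    ∀ᶠ x in 𝓝 0, |g x| ≤ ε * infDist x Z ^ k ∧ ‖fderiv ℝ g x‖ ≤ ε * infDist x Z ^ (k - 1) := by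
  have hsmall : ∀ᶠ y in 𝓝 0, ‖iteratedFDeriv ℝ k g y‖ ≤ ε := by
    have h1 : Tendsto (fun y => ‖iteratedFDeriv ℝ k g y‖) (𝓝 0) (𝓝 0) := by
      have := (hg.self_of_nhds.continuousAt_iteratedFDeriv (k := k) le_rfl).norm.tendsto
      rwa [hflat.self_of_nhds h0 k le_rfl, norm_zero] at this
    exact (h1.eventually_lt_const hε).mono fun y hy => hy.le
  obtain ⟨r, hr, hball⟩ := Metric.mem_nhds_iff.1 ((hg.and hflat).and hsmall)
  filter_upwards [ball_mem_nhds 0 (show 0 < r / 4 by positivity)] with x hx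
  rw [mem_ball_zero_iff] at hx
  have key : ∀ᶠ η in 𝓝[>] (0 : ℝ), |g x| ≤ ε * (infDist x Z + η) ^ k ∧
      ‖fderiv ℝ g x‖ ≤ ε * (infDist x Z + η) ^ (k - 1) := by
    filter_upwards [Ioo_mem_nhdsGT (show (0 : ℝ) < r / 4 by positivity)] with η hη
    obtain ⟨a, haZ, ha⟩ := (infDist_lt_iff ⟨0, h0⟩).1 (lt_add_of_pos_right (infDist x Z) hη.1)
    rw [dist_eq_norm] at ha
    have hxZ : infDist x Z ≤ ‖x‖ := by simpa using infDist_le_dist_of_mem (x := x) h0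
    have har : a ∈ ball (0 : E) r := by
      rw [mem_ball_zero_iff]
      have := norm_sub_norm_le a x
      rw [norm_sub_rev] at this
      have := hη.2
      linarith
    have hxr : x ∈ ball (0 : E) r := by
      rw [mem_ball_zero_iff]; linarith
    have h1 := norm_iteratedFDeriv_le_of_flat (convex_ball (0 : E) r)
      (fun y hy => (hball hy).1.1) har ((hball har).1.2 haZ) (fun y hy => (hball hy).2)
    have h2 := h1 k le_rfl x hxr
    have h3 := h1 (k - 1) (by omega) x hxr
    rw [Nat.sub_self, norm_iteratedFDeriv_zero] at h2
    rw [show k - (k - 1) = 1 by omega, norm_iteratedFDeriv_one] at h3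
    exact ⟨h2.trans (by gcongr), h3.trans (by gcongr)⟩
  have hlim : ∀ m : ℕ, Tendsto (fun η : ℝ => ε * (infDist x Z + η) ^ m) (𝓝[>] 0)
      (𝓝 (ε * infDist x Z ^ m)) := fun m => by
    have : Continuous fun η : ℝ => ε * (infDist x Z + η) ^ m := by fun_prop
    simpa using (this.tendsto 0).mono_left nhdsWithin_le_nhds
  exact ⟨ge_of_tendsto (hlim k) (key.mono fun η h => h.1),
    ge_of_tendsto (hlim (k - 1)) (key.mono fun η h => h.2)⟩

end FlatFunctions

/-- `α` is a trajectory on `[0, 1]` of the time-dependent vector field `X`, contained in `S`. -/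
def IsTrajectoryIn {E : Type*} [NormedAddCommGroup E] [NormedSpace ℝ E] (X : ℝ → E → E)
    (S : Set E) (α : ℝ → E) : Prop :=
  ∀ t ∈ Set.Icc (0 : ℝ) 1, HasDerivWithinAt α (X t (α t)) (Set.Icc 0 1) t ∧ α t ∈ S

/-- A time-dependent vector field on the closed ball of radius `R` dominated by a weight `ρ`, and
regular where `ρ` does not vanish. -/
structure IsDominatedField {E : Type*} [NormedAddCommGroup E] (ρ : E → ℝ) (R : ℝ)
    (X : ℝ → E → E) : Prop where
  norm_le : ∀ t ∈ Set.Icc (0 : ℝ) 1, ∀ x ∈ Metric.closedBall (0 : E) R, ‖X t x‖ ≤ ρ x / 4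
  lipschitz : ∀ s > 0, ∃ K : NNReal, ∀ t ∈ Set.Icc (0 : ℝ) 1,
    LipschitzOnWith K (X t) {x ∈ Metric.closedBall (0 : E) R | s ≤ ρ x}
  continuousOn : ∀ x ∈ Metric.closedBall (0 : E) R, 0 < ρ x →
    ContinuousOn (fun t => X t x) (Set.Icc 0 1)

section Flow

open Metric Set Filter Topology

variable {E : Type*} [NormedAddCommGroup E]

lemma one_sub_mem_Icc {t : ℝ} (ht : t ∈ Icc (0 : ℝ) 1) : 1 - t ∈ Icc (0 : ℝ) 1 :=
  ⟨by linarith [ht.2], by linarith [ht.1]⟩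

lemma IsDominatedField.reverse {ρ : E → ℝ} {R : ℝ} {X : ℝ → E → E}
    (h : IsDominatedField ρ R X) : IsDominatedField ρ R (fun t x => -X (1 - t) x) where
  norm_le t ht x hx := by
    rw [norm_neg]
    exact h.norm_le _ (one_sub_mem_Icc ht) x hx
  lipschitz s hs := by
    obtain ⟨K, hK⟩ := h.lipschitz s hs
    exact ⟨K, fun t ht => (hK _ (one_sub_mem_Icc ht)).neg⟩
  continuousOn x hx hρ := by
    refine ((h.continuousOn x hx hρ).comp (f := fun t : ℝ => 1 - t)
      (by fun_prop) fun t ht => one_sub_mem_Icc ht).neg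

lemma closedBall_subset_of_weight {ρ : E → ℝ} {R : ℝ} (hρ : LipschitzWith 1 ρ) {x : E} (hx : ‖x‖ ≤ R / 2)
    (hρx : ρ x ≤ ‖x‖) :
    closedBall x (ρ x / 2) ⊆ {y ∈ closedBall (0 : E) R | ρ x / 2 ≤ ρ y} := by
  intro y hy
  rw [mem_closedBall] at hy
  have h1 := hρ.dist_le_mul x y
  rw [dist_comm x y, NNReal.coe_one, one_mul, Real.dist_eq] at h1
  have h2 : ‖y‖ ≤ ‖x‖ + dist y x := by
    rw [dist_eq_norm]
    simpa using norm_add_le x (y - x)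
  refine ⟨?_, by linarith [le_abs_self (ρ x - ρ y)]⟩
  rw [mem_closedBall_zero_iff]
  linarith [norm_nonneg x]

variable [NormedSpace ℝ E]

/-- The Picard-Lindelöf theorem, recording that the solution stays in the given ball. -/
lemma IsPicardLindelof.exists_hasDerivWithinAt_mem_closedBall [CompleteSpace E]
    {f : ℝ → E → E} {tmin tmax : ℝ} {t₀ : Icc tmin tmax} {x₀ x : E} {a r L K : NNReal}
    (hf : IsPicardLindelof f t₀ x₀ a r L K) (hx : x ∈ closedBall x₀ r) :
    ∃ α : ℝ → E, α t₀ = x ∧ ∀ t ∈ Icc tmin tmax,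
      HasDerivWithinAt α (f t (α t)) (Icc tmin tmax) t ∧ α t ∈ closedBall x₀ a := by
  obtain ⟨α, hα⟩ := ODE.FunSpace.exists_isFixedPt_next hf hx
  refine ⟨α.compProj, by rw [ODE.FunSpace.compProj_val, ← hα, ODE.FunSpace.next_apply₀],
    fun t ht => ⟨?_, α.compProj_mem_closedBall hf.mul_max_le⟩⟩
  apply ODE.hasDerivWithinAt_picard_Icc t₀.2 hf.continuousOn_uncurry
    α.continuous_compProj.continuousOn (fun _ ht' ↦ α.compProj_mem_closedBall hf.mul_max_le)
    x ht |>.congr_of_mem _ ht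
  intro t' ht'
  nth_rw 1 [← hα]
  rw [ODE.FunSpace.compProj_of_mem ht', ODE.FunSpace.next_apply]

lemma IsTrajectoryIn.mono {X : ℝ → E → E} {S T : Set E} {α : ℝ → E}
    (h : IsTrajectoryIn X S α) (hST : S ⊆ T) : IsTrajectoryIn X T α :=
  fun t ht => ⟨(h t ht).1, hST (h t ht).2⟩

lemma IsTrajectoryIn.reverse {X : ℝ → E → E} {S : Set E} {α : ℝ → E}
    (h : IsTrajectoryIn X S α) :
    IsTrajectoryIn (fun t x => -X (1 - t) x) S (fun t => α (1 - t)) := by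
  intro t ht
  refine ⟨?_, (h _ (one_sub_mem_Icc ht)).2⟩
  have h1 : HasDerivWithinAt (fun t : ℝ => 1 - t) (-1) (Icc 0 1) t := by
    simpa using (hasDerivWithinAt_id t (Icc (0 : ℝ) 1)).const_sub 1
  have h2 := (h _ (one_sub_mem_Icc ht)).1.scomp t h1 fun t ht => one_sub_mem_Icc ht
  simpa [Function.comp_def] using h2

lemma IsTrajectoryIn.dist_le {X : ℝ → E → E} {S : Set E} {K : NNReal}
    (hX : ∀ t ∈ Icc (0 : ℝ) 1, LipschitzOnWith K (X t) S) {α β : ℝ → E}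
    (hα : IsTrajectoryIn X S α) (hβ : IsTrajectoryIn X S β) :
    dist (α 1) (β 1) ≤ dist (α 0) (β 0) * Real.exp K := by
  have hmono : ∀ t ∈ Ico (0 : ℝ) 1, Icc (0 : ℝ) 1 ∈ 𝓝[≥] t := fun t ht => Icc_mem_nhdsGE_of_mem ht
  have := dist_le_of_trajectories_ODE_of_mem (v := X) (s := fun _ => S) (K := K) (a := 0) (b := 1)
    (f := α) (g := β)
    (fun t ht => hX t (Ico_subset_Icc_self ht))
    (fun t ht => (hα t ht).1.continuousWithinAt)
    (fun t ht => (hα t (Ico_subset_Icc_self ht)).1.mono_of_mem_nhdsWithin (hmono t ht))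
    (fun t ht => (hα t (Ico_subset_Icc_self ht)).2)
    (fun t ht => (hβ t ht).1.continuousWithinAt)
    (fun t ht => (hβ t (Ico_subset_Icc_self ht)).1.mono_of_mem_nhdsWithin (hmono t ht))
    (fun t ht => (hβ t (Ico_subset_Icc_self ht)).2) le_rfl 1 (by simp)
  simpa using this

variable {ρ : E → ℝ} {R : ℝ} {X : ℝ → E → E}

lemma IsDominatedField.exists_trajectory [CompleteSpace E] (h : IsDominatedField ρ R X)
    (hρ : LipschitzWith 1 ρ) {x : E} (hx : ‖x‖ ≤ R / 2) (hρx : ρ x ≤ ‖x‖) (hpos : 0 < ρ x) :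
    ∃ α : ℝ → E, α 0 = x ∧ IsTrajectoryIn X (closedBall x (ρ x / 2)) α := by
  have hsub := closedBall_subset_of_weight hρ hx hρx
  obtain ⟨K, hK⟩ := h.lipschitz (ρ x / 2) (by positivity)
  obtain ⟨r, hr⟩ : ∃ r : NNReal, (r : ℝ) = ρ x / 2 := ⟨⟨ρ x / 2, by positivity⟩, rfl⟩
  have hp : IsPicardLindelof X (tmin := 0) (tmax := 1) ⟨0, by simp⟩ x r 0 r K := by
    refine ⟨fun t ht => ?_, fun y hy => ?_, fun t ht y hy => ?_, by simp⟩
    · rw [hr]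
      exact (hK t ht).mono hsub
    · rw [hr] at hy
      have := hsub hy
      exact h.continuousOn y this.1 (lt_of_lt_of_le (by positivity) this.2)
    · rw [hr] at hy ⊢
      refine (h.norm_le t ht y (hsub hy).1).trans ?_
      have h1 := hρ.dist_le_mul y x
      have h2 : dist y x ≤ ρ x / 2 := hy
      rw [NNReal.coe_one, one_mul, Real.dist_eq] at h1
      linarith [le_abs_self (ρ y - ρ x)]
  obtain ⟨α, hα0, hα⟩ := hp.exists_hasDerivWithinAt_mem_closedBall (x := x) (by simp)
  rw [hr] at hα
  exact ⟨α, hα0, hα⟩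

/-- `φ` sends the start of trajectories of `X` to their end, and fixes the zeros of `ρ`. -/
def IsTimeOneMap (ρ : E → ℝ) (R : ℝ) (X : ℝ → E → E) (φ : E → E) : Prop :=
  ∀ x, ‖x‖ ≤ R / 2 → ‖φ x - x‖ ≤ ρ x / 2 ∧ (ρ x = 0 → φ x = x) ∧
    (0 < ρ x → ∃ α : ℝ → E, α 0 = x ∧ α 1 = φ x ∧ IsTrajectoryIn X (closedBall x (ρ x / 2)) α)

lemma IsDominatedField.exists_isTimeOneMap [CompleteSpace E] (h : IsDominatedField ρ R X)
    (hρ : LipschitzWith 1 ρ) (hρ0 : ∀ x, 0 ≤ ρ x) (hle : ∀ x, ρ x ≤ ‖x‖) :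
    ∃ φ, IsTimeOneMap ρ R X φ := by
  have key : ∀ x, ∃ y, ‖x‖ ≤ R / 2 → ‖y - x‖ ≤ ρ x / 2 ∧ (ρ x = 0 → y = x) ∧
      (0 < ρ x → ∃ α : ℝ → E, α 0 = x ∧ α 1 = y ∧ IsTrajectoryIn X (closedBall x (ρ x / 2)) α) := by
    intro x
    by_cases hx : ‖x‖ ≤ R / 2
    · rcases (hρ0 x).eq_or_lt with h0 | h0
      · exact ⟨x, fun _ => ⟨by simpa using by linarith, fun _ => rfl, fun h => by linarith⟩⟩
      · obtain ⟨α, hα0, hα⟩ := h.exists_trajectory hρ hx (hle x) h0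
        refine ⟨α 1, fun _ => ⟨?_, fun h => by linarith, fun _ => ⟨α, hα0, rfl, hα⟩⟩⟩
        have := (hα 1 (by simp)).2
        rwa [mem_closedBall, dist_eq_norm] at this
    · exact ⟨x, fun h => absurd h hx⟩
  choose φ hφ using key
  exact ⟨φ, hφ⟩

lemma IsTimeOneMap.norm_le {φ : E → E} (hφ : IsTimeOneMap ρ R X φ) (hle : ∀ x, ρ x ≤ ‖x‖)
    {x : E} (hx : ‖x‖ ≤ R / 2) : ‖φ x‖ ≤ 3 / 2 * ‖x‖ := by
  have h1 := (hφ x hx).1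
  have h2 : ‖φ x‖ ≤ ‖φ x - x‖ + ‖x‖ := by simpa using norm_add_le (φ x - x) x
  linarith [hle x]

lemma IsTimeOneMap.leftInverse {φ ψ : E → E} (h : IsDominatedField ρ R X)
    (hρ : LipschitzWith 1 ρ) (hρ0 : ∀ x, 0 ≤ ρ x) (hle : ∀ x, ρ x ≤ ‖x‖)
    (hφ : IsTimeOneMap ρ R X φ) (hψ : IsTimeOneMap ρ R (fun t x => -X (1 - t) x) ψ)
    {x : E} (hx : ‖x‖ ≤ R / 4) : ψ (φ x) = x := by
  have hx2 : ‖x‖ ≤ R / 2 := by linarith [norm_nonneg x]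
  have hy2 : ‖φ x‖ ≤ R / 2 := by linarith [hφ.norm_le hle hx2, norm_nonneg x]
  rcases (hρ0 x).eq_or_lt with h0 | h0
  · have := (hφ x hx2).2.1 h0.symm
    rw [this]
    exact (hψ x hx2).2.1 h0.symm
  · obtain ⟨α, hα0, hα1, hα⟩ := (hφ x hx2).2.2 h0
    have hsub := closedBall_subset_of_weight (R := R) hρ hx2 (hle x)
    have hy : ρ x / 2 ≤ ρ (φ x) := by
      rw [← hα1]
      exact (hsub (hα 1 (by simp)).2).2
    obtain ⟨β, hβ0, hβ1, hβ⟩ := (hψ (φ x) hy2).2.2 (by linarith)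
    have hsub' := closedBall_subset_of_weight (R := R) hρ hy2 (hle (φ x))
    obtain ⟨K, hK⟩ := h.reverse.lipschitz (ρ x / 4) (by positivity)
    have := IsTrajectoryIn.dist_le hK
      (hα.reverse.mono fun y hy => ⟨(hsub hy).1, by linarith [(hsub hy).2]⟩)
      (hβ.mono fun z hz => ⟨(hsub' hz).1, by linarith [(hsub' hz).2]⟩)
    simp only [sub_self, sub_zero, hα1, hβ0, dist_self, zero_mul, hα0, hβ1] at this
    exact (dist_le_zero.1 this).symm

lemma IsTimeOneMap.continuousOn {φ : E → E} (h : IsDominatedField ρ R X)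
    (hρ : LipschitzWith 1 ρ) (hρ0 : ∀ x, 0 ≤ ρ x) (hle : ∀ x, ρ x ≤ ‖x‖)
    (hφ : IsTimeOneMap ρ R X φ) : ContinuousOn φ (ball 0 (R / 2)) := by
  intro x hx
  apply ContinuousAt.continuousWithinAt
  have hball : ∀ᶠ y in 𝓝 x, ‖y‖ ≤ R / 2 := by
    filter_upwards [isOpen_ball.mem_nhds hx] with y hy
    exact (mem_ball_zero_iff.1 hy).le
  have hx2 := hball.self_of_nhds
  rw [ContinuousAt, tendsto_iff_dist_tendsto_zero]
  rcases (hρ0 x).eq_or_lt with h0 | h0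
  · rw [(hφ x hx2).2.1 h0.symm]
    have hlim : Tendsto (fun y => ρ y / 2 + dist y x) (𝓝 x) (𝓝 0) := by
      have : Tendsto (fun y => ρ y / 2 + dist y x) (𝓝 x) (𝓝 (ρ x / 2 + dist x x)) :=
        ((hρ.continuous.div_const 2).add (by fun_prop)).tendsto x
      simpa [← h0] using this
    refine squeeze_zero' (Eventually.of_forall fun _ => dist_nonneg) ?_ hlim
    filter_upwards [hball] with y hy
    have := (hφ y hy).1
    rw [← dist_eq_norm] at this
    linarith [dist_triangle (φ y) y x]
  · obtain ⟨K, hK⟩ := h.lipschitz (ρ x / 4) (by positivity)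
    have hlim : Tendsto (fun y => dist y x * Real.exp K) (𝓝 x) (𝓝 0) := by
      have : Tendsto (fun y => dist y x * Real.exp K) (𝓝 x) (𝓝 (dist x x * Real.exp K)) :=
        (Continuous.mul (by fun_prop) continuous_const).tendsto x
      simpa using this
    have hev : ∀ᶠ y in 𝓝 x, ρ x / 2 < ρ y :=
      hρ.continuous.continuousAt.eventually (lt_mem_nhds (by linarith))
    refine squeeze_zero' (Eventually.of_forall fun _ => dist_nonneg) ?_ hlim
    filter_upwards [hball, hev] with y hy hy2
    obtain ⟨α, hα0, hα1, hα⟩ := (hφ x hx2).2.2 h0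
    obtain ⟨β, hβ0, hβ1, hβ⟩ := (hφ y hy).2.2 (by linarith)
    have hsub := closedBall_subset_of_weight (R := R) hρ hx2 (hle x)
    have hsub' := closedBall_subset_of_weight (R := R) hρ hy (hle y)
    have := IsTrajectoryIn.dist_le hK
      (hβ.mono fun z hz => ⟨(hsub' hz).1, by linarith [(hsub' hz).2]⟩)
      (hα.mono fun y hy => ⟨(hsub hy).1, by linarith [(hsub hy).2]⟩)
    rwa [hα0, hα1, hβ0, hβ1] at this

theorem IsDominatedField.exists_homeomorph [CompleteSpace E] (h : IsDominatedField ρ R X)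
    (hR : 0 < R) (hρ : LipschitzWith 1 ρ) (hρ0 : ∀ x, 0 ≤ ρ x) (hle : ∀ x, ρ x ≤ ‖x‖) :
    ∃ Ω₁ Ω₂ : Set E, IsOpen Ω₁ ∧ IsOpen Ω₂ ∧ 0 ∈ Ω₁ ∧ 0 ∈ Ω₂ ∧ Ω₁ ⊆ closedBall 0 R ∧
      Ω₂ ⊆ closedBall 0 R ∧ ∃ φ : Ω₁ ≃ₜ Ω₂, ∀ x : Ω₁, (ρ x = 0 → (φ x : E) = x) ∧
        (0 < ρ x → ∃ α : ℝ → E, α 0 = x ∧ α 1 = φ x ∧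
          IsTrajectoryIn X {y ∈ closedBall 0 R | 0 < ρ y} α) := by
  obtain ⟨φ, hφ⟩ := h.exists_isTimeOneMap hρ hρ0 hle
  obtain ⟨ψ, hψ⟩ := h.reverse.exists_isTimeOneMap hρ hρ0 hle
  have hψφ : ∀ x : E, ‖x‖ ≤ R / 4 → ψ (φ x) = x := fun x hx =>
    IsTimeOneMap.leftInverse h hρ hρ0 hle hφ hψ hx
  have hφψ : ∀ x : E, ‖x‖ ≤ R / 4 → φ (ψ x) = x := fun x hx =>
    IsTimeOneMap.leftInverse h.reverse hρ hρ0 hle hψ (by simpa using hφ) hx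
  have hcφ := hφ.continuousOn h hρ hρ0 hle
  have hcψ := hψ.continuousOn h.reverse hρ hρ0 hle
  have h00 : ρ 0 = 0 := le_antisymm (by simpa using hle 0) (hρ0 0)
  have hψ0 : ψ 0 = 0 := (hψ 0 (by simp; positivity)).2.1 h00
  have hs1 : ball (0 : E) (R / 8) ⊆ ball 0 (R / 2) := ball_subset_ball (by linarith)
  have hs2 : ball (0 : E) (R / 4) ⊆ ball 0 (R / 2) := ball_subset_ball (by linarith)
  have hmaps : ∀ x ∈ ball (0 : E) (R / 8), φ x ∈ ball 0 (R / 4) ∩ ψ ⁻¹' ball 0 (R / 8) := by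
    intro x hx
    have hx' := mem_ball_zero_iff.1 hx
    refine ⟨mem_ball_zero_iff.2 ?_, ?_⟩
    · linarith [hφ.norm_le hle (x := x) (by linarith)]
    · rw [mem_preimage, hψφ x (by linarith)]
      exact hx
  refine ⟨ball 0 (R / 8), ball 0 (R / 4) ∩ ψ ⁻¹' ball 0 (R / 8), isOpen_ball,
    (hcψ.mono hs2).isOpen_inter_preimage isOpen_ball isOpen_ball, mem_ball_self (by positivity),
    ⟨mem_ball_self (by positivity), by rw [mem_preimage, hψ0]; exact mem_ball_self (by positivity)⟩,
    (ball_subset_ball (by linarith)).trans ball_subset_closedBall,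
    inter_subset_left.trans ((ball_subset_ball (by linarith)).trans ball_subset_closedBall),
    { toFun := fun x => ⟨φ x, hmaps x x.2⟩
      invFun := fun y => ⟨ψ y, y.2.2⟩
      left_inv := fun x => Subtype.ext (hψφ x (by linarith [mem_ball_zero_iff.1 x.2]))
      right_inv := fun y => Subtype.ext (hφψ y (mem_ball_zero_iff.1 y.2.1).le)
      continuous_toFun := ((hcφ.mono hs1).domRestrict).subtype_mk _
      continuous_invFun := ((hcψ.mono (inter_subset_left.trans hs2)).domRestrict).subtype_mk _ }, ?_⟩
  intro x
  have hx2 : ‖(x : E)‖ ≤ R / 2 := by linarith [mem_ball_zero_iff.1 x.2]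
  refine ⟨(hφ x hx2).2.1, fun hpos => ?_⟩
  obtain ⟨α, hα0, hα1, hα⟩ := (hφ x hx2).2.2 hpos
  have hsub := closedBall_subset_of_weight (R := R) hρ hx2 (hle x)
  exact ⟨α, hα0, hα1, hα.mono fun y hy => ⟨(hsub hy).1, by linarith [(hsub hy).2]⟩⟩

end Flow

section Interpolation

open Metric Set Filter Topology

variable {E : Type*} [NormedAddCommGroup E] [InnerProductSpace ℝ E]

lemma contDiffAt_comp_snd {F : Type*} [NormedAddCommGroup F] [NormedSpace ℝ F] {g : E → F}
    {m : WithTop ℕ∞} {t : ℝ} {x : E} (hg : ContDiffAt ℝ m g x) :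
    ContDiffAt ℝ m (fun p : ℝ × E => g p.2) (t, x) :=
  ContDiffAt.comp (t, x) (g := g) hg contDiffAt_snd

variable [FiniteDimensional ℝ E]

/-- Gradient of the interpolation `f₂ + t (f₁ - f₂)`. -/
noncomputable def interpolationGradient (f₁ f₂ : E → ℝ) (t : ℝ) (x : E) : E :=
  (InnerProductSpace.toDual ℝ E).symm (fderiv ℝ f₂ x + t • (fderiv ℝ f₁ x - fderiv ℝ f₂ x))

/-- Vector field whose trajectories preserve the interpolation `f₂ + t (f₁ - f₂)`. -/
noncomputable def interpolationField (f₁ f₂ : E → ℝ) (t : ℝ) (x : E) : E :=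
  -((f₁ x - f₂ x) / ‖interpolationGradient f₁ f₂ t x‖ ^ 2) • interpolationGradient f₁ f₂ t x

variable {f₁ f₂ : E → ℝ}

lemma norm_interpolationField (t : ℝ) (x : E) :
    ‖interpolationField f₁ f₂ t x‖ = |f₁ x - f₂ x| / ‖interpolationGradient f₁ f₂ t x‖ := by
  unfold interpolationField
  rw [norm_smul, norm_neg, norm_div, Real.norm_eq_abs, norm_pow, norm_norm]
  rcases eq_or_ne ‖interpolationGradient f₁ f₂ t x‖ 0 with h | h
  · simp [h]
  · field_simp

lemma contDiffAt_interpolationField {t : ℝ} {x : E} (h₁ : ContDiffAt ℝ 2 f₁ x)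
    (h₂ : ContDiffAt ℝ 2 f₂ x) (h : interpolationGradient f₁ f₂ t x ≠ 0) :
    ContDiffAt ℝ 1 (fun p : ℝ × E => interpolationField f₁ f₂ p.1 p.2) (t, x) := by
  have hd₁ := contDiffAt_comp_snd (t := t) (h₁.fderiv_right (m := 1) (by norm_num))
  have hd₂ := contDiffAt_comp_snd (t := t) (h₂.fderiv_right (m := 1) (by norm_num))
  have hv : ContDiffAt ℝ 1 (fun p : ℝ × E => interpolationGradient f₁ f₂ p.1 p.2) (t, x) := by
    unfold interpolationGradient
    exact (InnerProductSpace.toDual ℝ E).symm.contDiff.contDiffAt.comp (t, x)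
      (hd₂.add (contDiffAt_fst.smul (hd₁.sub hd₂)))
  unfold interpolationField
  refine ContDiffAt.smul (ContDiffAt.neg (ContDiffAt.div ?_ (hv.norm_sq ℝ) ?_)) hv
  · exact (contDiffAt_comp_snd (t := t) (h₁.of_le one_le_two)).sub (contDiffAt_comp_snd (t := t) (h₂.of_le one_le_two))
  · simpa using h

lemma interpolation_derivative_eq_zero {t : ℝ} {x : E}
    (h : interpolationGradient f₁ f₂ t x ≠ 0) :
    (fderiv ℝ f₂ x + t • (fderiv ℝ f₁ x - fderiv ℝ f₂ x)) (interpolationField f₁ f₂ t x)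
      + (f₁ x - f₂ x) = 0 := by
  have key : ∀ w, (fderiv ℝ f₂ x + t • (fderiv ℝ f₁ x - fderiv ℝ f₂ x)) w =
      inner ℝ (interpolationGradient f₁ f₂ t x) w := by
    intro w
    unfold interpolationGradient
    rw [InnerProductSpace.toDual_symm_apply]
  rw [key]
  unfold interpolationField
  rw [inner_smul_right, real_inner_self_eq_norm_sq]
  have : ‖interpolationGradient f₁ f₂ t x‖ ≠ 0 := norm_ne_zero_iff.2 h
  field_simp
  ring

lemma IsTrajectoryIn.interpolation_eq {S : Set E} {α : ℝ → E}
    (hα : IsTrajectoryIn (interpolationField f₁ f₂) S α)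
    (h₁ : ∀ x ∈ S, DifferentiableAt ℝ f₁ x) (h₂ : ∀ x ∈ S, DifferentiableAt ℝ f₂ x)
    (hne : ∀ t ∈ Icc (0 : ℝ) 1, ∀ x ∈ S, interpolationGradient f₁ f₂ t x ≠ 0) :
    f₁ (α 1) = f₂ (α 0) := by
  have hder : ∀ t ∈ Icc (0 : ℝ) 1, HasDerivWithinAt
      (fun t => f₂ (α t) + t * (f₁ (α t) - f₂ (α t))) 0 (Icc 0 1) t := by
    intro t ht
    obtain ⟨hd, hm⟩ := hα t ht
    have hd₁ := (h₁ _ hm).hasFDerivAt.comp_hasDerivWithinAt t hd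
    have hd₂ := (h₂ _ hm).hasFDerivAt.comp_hasDerivWithinAt t hd
    have := hd₂.add ((hasDerivWithinAt_id t (Icc (0 : ℝ) 1)).mul (hd₁.sub hd₂))
    refine this.congr_deriv ?_
    rw [← interpolation_derivative_eq_zero (hne t ht _ hm)]
    simp
    ring
  have := norm_image_sub_le_of_norm_deriv_le_segment_01' (C := 0) hder (by simp)
  have := sub_eq_zero.1 (norm_le_zero_iff.1 this)
  simpa using this

theorem exists_homeomorph_of_gradient_control {Z : Set E} (hZ : 0 ∈ Z) {k : ℕ} (hk : 1 ≤ k)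
    (h₁ : ∀ᶠ x in 𝓝 0, ContDiffAt ℝ 2 f₁ x) (h₂ : ∀ᶠ x in 𝓝 0, ContDiffAt ℝ 2 f₂ x) {c : ℝ}
    (hc : 0 < c) (hgrad : ∀ᶠ x in 𝓝 0, c * infDist x Z ^ (k - 1) ≤ ‖fderiv ℝ f₂ x‖)
    (hsub : ∀ᶠ x in 𝓝 0, |f₁ x - f₂ x| ≤ c / 8 * infDist x Z ^ k ∧
      ‖fderiv ℝ f₁ x - fderiv ℝ f₂ x‖ ≤ c / 2 * infDist x Z ^ (k - 1))
    {V : Set E} (hV : V ∈ 𝓝 0) :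
    ∃ Ω₁ Ω₂ : Set E, IsOpen Ω₁ ∧ IsOpen Ω₂ ∧ 0 ∈ Ω₁ ∧ 0 ∈ Ω₂ ∧ Ω₁ ⊆ V ∧ Ω₂ ⊆ V ∧
      ∃ φ : Ω₁ ≃ₜ Ω₂, ∀ x : Ω₁, f₁ (φ x) = f₂ x := by
  have hev := h₁.and (h₂.and (hgrad.and (hsub.and (show ∀ᶠ x in 𝓝 0, x ∈ V from hV))))
  obtain ⟨R, hR, hRV⟩ := Metric.nhds_basis_closedBall.eventually_iff.1 hev
  set ρ : E → ℝ := fun x => infDist x Z with hρdef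
  have hρ0 : ∀ x, 0 ≤ ρ x := fun x => infDist_nonneg
  have hρ : LipschitzWith 1 ρ := lipschitz_infDist_pt Z
  have hle : ∀ x, ρ x ≤ ‖x‖ := fun x => by simpa using infDist_le_dist_of_mem (x := x) hZ
  have hlow : ∀ t ∈ Icc (0 : ℝ) 1, ∀ x ∈ closedBall (0 : E) R,
      c / 2 * ρ x ^ (k - 1) ≤ ‖interpolationGradient f₁ f₂ t x‖ := by
    intro t ht x hx
    obtain ⟨-, -, h3, ⟨-, h4⟩, -⟩ := hRV hx
    unfold interpolationGradient
    rw [LinearIsometryEquiv.norm_map]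
    have h5 := norm_sub_norm_le (fderiv ℝ f₂ x) (-(t • (fderiv ℝ f₁ x - fderiv ℝ f₂ x)))
    rw [sub_neg_eq_add, norm_neg, norm_smul, Real.norm_of_nonneg ht.1] at h5
    have h6 : t * ‖fderiv ℝ f₁ x - fderiv ℝ f₂ x‖ ≤ ‖fderiv ℝ f₁ x - fderiv ℝ f₂ x‖ :=
      mul_le_of_le_one_left (norm_nonneg _) ht.2
    simp only [hρdef]
    linarith
  have hne : ∀ t ∈ Icc (0 : ℝ) 1, ∀ x ∈ closedBall (0 : E) R, 0 < ρ x →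
      interpolationGradient f₁ f₂ t x ≠ 0 := by
    intro t ht x hx hpos
    refine norm_pos_iff.1 (lt_of_lt_of_le ?_ (hlow t ht x hx))
    positivity
  have hsmooth : ∀ t ∈ Icc (0 : ℝ) 1, ∀ x ∈ closedBall (0 : E) R, 0 < ρ x →
      ContDiffAt ℝ 1 (fun p : ℝ × E => interpolationField f₁ f₂ p.1 p.2) (t, x) :=
    fun t ht x hx hpos => contDiffAt_interpolationField (hRV hx).1 (hRV hx).2.1 (hne t ht x hx hpos)
  have hzero : ∀ x ∈ closedBall (0 : E) R, ρ x = 0 → f₁ x - f₂ x = 0 := by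
    intro x hx h0
    have := (hRV hx).2.2.2.1.1
    rw [show infDist x Z = 0 from h0, zero_pow (by omega), mul_zero] at this
    exact abs_nonpos_iff.1 this
  have hdom : IsDominatedField ρ R (interpolationField f₁ f₂) := by
    refine ⟨fun t ht x hx => ?_, fun s hs => ?_, fun x hx hpos t ht => ?_⟩
    · rw [norm_interpolationField]
      rcases (hρ0 x).eq_or_lt with h0 | h0
      · rw [hzero x hx h0.symm, ← h0]
        simp
      · have hg := hlow t ht x hx
        have hp : 0 < c / 2 * ρ x ^ (k - 1) := by positivity
        rw [div_le_iff₀ (hp.trans_le hg)]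
        calc |f₁ x - f₂ x| ≤ c / 8 * ρ x ^ k := (hRV hx).2.2.2.1.1
          _ = ρ x / 4 * (c / 2 * ρ x ^ (k - 1)) := by
            obtain ⟨m, rfl⟩ := Nat.exists_eq_add_of_le' hk
            rw [Nat.add_sub_cancel]
            ring
          _ ≤ _ := by gcongr
    · set T : Set E := {x ∈ closedBall (0 : E) R | s ≤ ρ x}
      have hT : IsCompact T :=
        (isCompact_closedBall 0 R).inter_right (isClosed_le continuous_const hρ.continuous)
      have hloc : LocallyLipschitzOn (Icc (0 : ℝ) 1 ×ˢ T)
          (fun p : ℝ × E => interpolationField f₁ f₂ p.1 p.2) := by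
        rintro ⟨t, x⟩ ⟨ht, hx⟩
        obtain ⟨K, u, hu, hK⟩ :=
          (hsmooth t ht x hx.1 (hs.trans_le hx.2)).exists_lipschitzOnWith
        exact ⟨K, u, mem_nhdsWithin_of_mem_nhds hu, hK⟩
      obtain ⟨K, hK⟩ := hloc.exists_lipschitzOnWith_of_compact (isCompact_Icc.prod hT)
      refine ⟨K, fun t ht => LipschitzOnWith.of_dist_le_mul fun x hx y hy => ?_⟩
      have := hK.dist_le_mul (t, x) ⟨ht, hx⟩ (t, y) ⟨ht, hy⟩
      simpa [Prod.dist_eq] using this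
    · have h1 := (hsmooth t ht x hx hpos).continuousAt
      exact (ContinuousAt.comp (f := fun t : ℝ => (t, x)) h1 (by fun_prop)).continuousWithinAt
  obtain ⟨Ω₁, Ω₂, ho₁, ho₂, h0₁, h0₂, hs₁, hs₂, φ, hφ⟩ := hdom.exists_homeomorph hR hρ hρ0 hle
  refine ⟨Ω₁, Ω₂, ho₁, ho₂, h0₁, h0₂, fun x hx => (hRV (hs₁ hx)).2.2.2.2,
    fun x hx => (hRV (hs₂ hx)).2.2.2.2, φ, fun x => ?_⟩
  rcases (hρ0 x).eq_or_lt with h0 | h0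
  · rw [(hφ x).1 h0.symm]
    exact sub_eq_zero.1 (hzero x (hs₁ x.2) h0.symm)
  · obtain ⟨α, hα0, hα1, hα⟩ := (hφ x).2 h0
    rw [← hα0, ← hα1]
    exact hα.interpolation_eq (fun y hy => (hRV hy.1).1.differentiableAt (by norm_num))
      (fun y hy => (hRV hy.1).2.1.differentiableAt (by norm_num))
      fun t ht y hy => hne t ht y hy.1 hy.2

end Interpolation

theorem stmt_15 (n : ℕ) (U : Set (EuclideanSpace ℝ (Fin n))) (hUopen : IsOpen U)
    (hUconn : IsConnected U) (h0U : (0 : EuclideanSpace ℝ (Fin n)) ∈ U)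
    (f : EuclideanSpace ℝ (Fin n) → ℝ) (hf : AnalyticOnNhd ℝ f U)
    (hfne : ∃ x ∈ U, f x ≠ 0) (hf0 : f 0 = 0)
    (P : MvPolynomial (Fin (n + 1)) ℝ) (hPirr : Irreducible P)
    (hPf : ∀ x ∈ U, MvPolynomial.eval (Fin.snoc (fun i => x i) (f x)) P = 0)
    (d : ℕ) (hd : d = P.totalDegree)
    (Z : Set (EuclideanSpace ℝ (Fin n))) (hZ : Z = {x ∈ U | f x = 0})
    (k : ℕ) (hk : k = 2 * (2 * d - 1) ^ (3 * n + 1))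
    (U₁ U₂ : Set (EuclideanSpace ℝ (Fin n)))
    (hU₁ : IsOpen U₁) (h0U₁ : (0 : EuclideanSpace ℝ (Fin n)) ∈ U₁)
    (hU₂ : IsOpen U₂) (h0U₂ : (0 : EuclideanSpace ℝ (Fin n)) ∈ U₂)
    (f₁ f₂ : EuclideanSpace ℝ (Fin n) → ℝ)
    (hf₁ : ContDiffOn ℝ k f₁ U₁) (hf₂ : ContDiffOn ℝ k f₂ U₂)
    (hreal₁ : ∃ W ∈ nhds (0 : EuclideanSpace ℝ (Fin n)), W ⊆ U₁ ∧
      ∀ a ∈ Z ∩ W, ∀ i ≤ k, iteratedFDeriv ℝ i f a = iteratedFDeriv ℝ i f₁ a)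
    (hreal₂ : ∃ W ∈ nhds (0 : EuclideanSpace ℝ (Fin n)), W ⊆ U₂ ∧
      ∀ a ∈ Z ∩ W, ∀ i ≤ k, iteratedFDeriv ℝ i f a = iteratedFDeriv ℝ i f₂ a) :
    ∃ Ω₁ Ω₂ : Set (EuclideanSpace ℝ (Fin n)), IsOpen Ω₁ ∧ IsOpen Ω₂ ∧
      (0 : EuclideanSpace ℝ (Fin n)) ∈ Ω₁ ∧ (0 : EuclideanSpace ℝ (Fin n)) ∈ Ω₂ ∧
      Ω₁ ⊆ U₂ ∧ Ω₂ ⊆ U₁ ∧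
      ∃ φ : Ω₁ ≃ₜ Ω₂, ∀ x : Ω₁, f₁ ((φ x : Ω₂) : EuclideanSpace ℝ (Fin n)) =
        f₂ (x : EuclideanSpace ℝ (Fin n)) := by
  have hdeg : 1 ≤ P.totalDegree := by
    by_contra hlt
    rw [MvPolynomial.totalDegree_eq_zero_iff_eq_C.1 (by omega : P.totalDegree = 0)] at hPirr
    refine hPirr.not_isUnit ((isUnit_iff_ne_zero.2 fun h => ?_).map MvPolynomial.C)
    rw [h, map_zero] at hPirr
    exact hPirr.ne_zero rfl
  have hk2 : 2 ≤ k := by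
    rw [hk]
    have : 1 ≤ (2 * d - 1) ^ (3 * n + 1) := Nat.one_le_pow _ _ (by omega)
    omega
  obtain ⟨C, -, hC⟩ := exists_gradient_inequality hUopen h0U hf hf0 hPirr hdeg
    (fun x hx => by unfold evalAt; exact hPf x hx)
  rw [← hd, ← hk] at hC
  have hZ0 : (0 : EuclideanSpace ℝ (Fin n)) ∈ Z := by
    rw [hZ]
    exact ⟨h0U, hf0⟩
  obtain ⟨c, hc, hcf⟩ := exists_gradient_distance_inequality hUopen h0U
    (fun x hx => (hf x hx).differentiableAt) hf0 (by omega) hC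
  rw [← hZ] at hcf
  have hsf : ∀ᶠ x in nhds 0, ContDiffAt ℝ k f x := by
    filter_upwards [hUopen.mem_nhds h0U] with x hx using (hf x hx).contDiffAt
  have hs₁ : ∀ᶠ x in nhds 0, ContDiffAt ℝ k f₁ x := by
    filter_upwards [hU₁.mem_nhds h0U₁] with x hx using hf₁.contDiffAt (hU₁.mem_nhds hx)
  have hs₂ : ∀ᶠ x in nhds 0, ContDiffAt ℝ k f₂ x := by
    filter_upwards [hU₂.mem_nhds h0U₂] with x hx using hf₂.contDiffAt (hU₂.mem_nhds hx)
  obtain ⟨W₁, hW₁, -, hj₁⟩ := hreal₁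
  obtain ⟨W₂, hW₂, -, hj₂⟩ := hreal₂
  have hflat : ∀ᶠ a in nhds 0, a ∈ Z → ∀ i ≤ k, iteratedFDeriv ℝ i (f₂ - f) a = 0 := by
    filter_upwards [hsf, hs₂, hW₂] with a ha ha₂ haW haZ i hi
    have hik : (i : WithTop ℕ∞) ≤ k := by exact_mod_cast hi
    rw [iteratedFDeriv_sub_apply (ha₂.of_le hik) (ha.of_le hik), hj₂ a ⟨haZ, haW⟩ i hi, sub_self]
  have hflat₁₂ : ∀ᶠ a in nhds 0, a ∈ Z → ∀ i ≤ k, iteratedFDeriv ℝ i (f₁ - f₂) a = 0 := by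
    filter_upwards [hs₁, hs₂, hW₁, hW₂] with a ha₁ ha₂ haW₁ haW₂ haZ i hi
    have hik : (i : WithTop ℕ∞) ≤ k := by exact_mod_cast hi
    rw [iteratedFDeriv_sub_apply (ha₁.of_le hik) (ha₂.of_le hik), ← hj₁ a ⟨haZ, haW₁⟩ i hi,
      hj₂ a ⟨haZ, haW₂⟩ i hi, sub_self]
  have hk1 : 1 ≤ k := by omega
  have hkne : (k : WithTop ℕ∞) ≠ 0 := by exact_mod_cast (by omega : k ≠ 0)
  have hk2' : (2 : WithTop ℕ∞) ≤ k := by exact_mod_cast hk2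
  have hest := eventually_le_infDist_pow_of_flat hk1 hZ0
    (by filter_upwards [hs₂, hsf] with x h1 h2 using h1.sub h2) hflat (half_pos hc)
  have hest₁₂ := eventually_le_infDist_pow_of_flat hk1 hZ0
    (by filter_upwards [hs₁, hs₂] with x h1 h2 using h1.sub h2) hflat₁₂
    (by positivity : 0 < c / 2 / 8)
  obtain ⟨Ω₁, Ω₂, ho₁, ho₂, h0₁, h0₂, hv₁, hv₂, φ, hφ⟩ :=
    exists_homeomorph_of_gradient_control (f₁ := f₁) (f₂ := f₂) hZ0 hk1
      (hs₁.mono fun x h => h.of_le hk2') (hs₂.mono fun x h => h.of_le hk2') (half_pos hc)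
      (by
        filter_upwards [hcf, hest, hsf, hs₂] with x h1 h2 h3 h4
        have h5 := h2.2
        rw [fderiv_sub (h4.differentiableAt hkne) (h3.differentiableAt hkne)] at h5
        linarith [norm_sub_norm_le (fderiv ℝ f x) (fderiv ℝ f₂ x),
          norm_sub_rev (fderiv ℝ f x) (fderiv ℝ f₂ x)])
      (by
        filter_upwards [hest₁₂, hs₁, hs₂] with x h1 h2 h3
        have h5 := h1.2
        rw [fderiv_sub (h2.differentiableAt hkne) (h3.differentiableAt hkne)] at h5
        refine ⟨h1.1, h5.trans ?_⟩
        have : 0 ≤ Metric.infDist x Z ^ (k - 1) := pow_nonneg Metric.infDist_nonneg _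
        nlinarith)
      (Filter.inter_mem (hU₁.mem_nhds h0U₁) (hU₂.mem_nhds h0U₂))
  exact ⟨Ω₁, Ω₂, ho₁, ho₂, h0₁, h0₂, fun x hx => (hv₁ hx).2, fun x hx => (hv₂ hx).1, φ, hφ⟩
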